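/- Let x be the horizontal component of the Peano curve and define φ : (0,1) → (0,+∞) by φ(c) = 1/(3^{⌊-log₃ c⌋}·(1 - (3/4)·3^{⌊-log₃ c⌋}·c)). Then φ(c) → 0 as c → 0+, and there exists a function L : [0,1] × ℝ → [0,1], Borel measurable in the second variable, satisfying the occupation time formula ∫_0^t g(x(s)) ds = ∫_ℝ g(z) L_t^z dz for all t ∈ [0,1] and all bounded Borel g, such that for every continuous g : ℝ → ℝ and every t ∈ [0,1], lim_{c→0+} ∫_ℝ φ(c)·n_t^{z,c}(x)·g(z) dz = ∫_ℝ L_t^z g(z) dz. -/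

import Mathlib

open scoped BigOperators Classical
open Filter

noncomputable section

/-- The digit map `k n = 2 - n` on `{0,1,2}` (with truncated natural subtraction). -/
def peanoK : ℕ → ℕ := fun n => 2 - n

/-- The `m`-th (0-indexed) ternary digit of the horizontal component of the Peano curve
evaluated at the point with ternary digits `d` (0-indexed, i.e. `t_j = d (j-1)`):
the `j`-th digit of `x(t)` is `k^[t_2 + t_4 + ⋯ + t_{2j-2}] (t_{2j-1})`. -/
def peanoXDigit (d : ℕ → Fin 3) (m : ℕ) : ℕ :=
  peanoK^[∑ i ∈ Finset.range m, (d (2 * i + 1) : ℕ)] (d (2 * m) : ℕ)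

/-- `x : ℝ → ℝ` is (on `[0,1]`) the horizontal component of the Peano curve:
for every ternary expansion `t = Σ_j d_j 3^{-(j+1)}`, `x t` is given by the digit formula. -/
def IsPeanoX (x : ℝ → ℝ) : Prop :=
  ∀ d : ℕ → Fin 3,
    x (∑' j : ℕ, (d j : ℝ) / 3 ^ (j + 1)) = ∑' m : ℕ, (peanoXDigit d m : ℝ) / 3 ^ (m + 1)

/-- The grid `cℤ + r = {cq + r : q ∈ ℤ}`. -/
def peanoGrid (c r : ℝ) : Set ℝ := {u : ℝ | ∃ q : ℤ, u = c * q + r}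

/-- `lebTime x c r m` is the time `t_{m+1}(c,r)` of the Lebesgue partition `π(c,r)` for `x`
on `[0,1]` (values in `[0,1] ∪ {+∞}`, modelled in `EReal`; `sInf ∅ = ⊤ = +∞`). -/
def lebTime (x : ℝ → ℝ) (c r : ℝ) : ℕ → EReal
  | 0 => sInf (Real.toEReal '' {t : ℝ | t ∈ Set.Icc (0 : ℝ) 1 ∧ x t ∈ peanoGrid c r})
  | m + 1 =>
    if lebTime x c r m = ⊤ then ⊤
    else
      sInf (Real.toEReal ''
        {t : ℝ | t ∈ Set.Icc ((lebTime x c r m).toReal) 1 ∧ x t ∈ peanoGrid c r ∧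
          x t ≠ x ((lebTime x c r m).toReal)})

/-- `k(c,r,t) = min{m ∈ ℕ₊ : t_m(c,r) ≥ t}` (recall `t_m(c,r) = lebTime x c r (m-1)`). -/
def kIdx (x : ℝ → ℝ) (c r t : ℝ) : ℕ :=
  sInf {m : ℕ | 1 ≤ m ∧ (t : EReal) ≤ lebTime x c r (m - 1)}

/-- `l(c,r,t) = max{m ∈ ℕ₊ : t_m(c,r) ≤ t}`. -/
def lIdx (x : ℝ → ℝ) (c r t : ℝ) : ℕ :=
  sSup {m : ℕ | 1 ≤ m ∧ lebTime x c r (m - 1) ≤ (t : EReal)}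

/-- The quadratic variation `[x]_{s,t}^{c,r}` of `x` on `[s,t]` along the Lebesgue partition
`π(c,r)`: the sum over `m = k(c,r,s), …, l(c,r,t) - 1` of `(x(t_{m+1}) - x(t_m))²`. -/
def qvar (x : ℝ → ℝ) (c r s t : ℝ) : ℝ :=
  ∑ m ∈ Finset.Ico (kIdx x c r s) (lIdx x c r t),
    (x ((lebTime x c r m).toReal) - x ((lebTime x c r (m - 1)).toReal)) ^ 2

/-- `[x]_t^{c,r} := [x]_{0,t}^{c,r}`. -/
def qvar0 (x : ℝ → ℝ) (c r t : ℝ) : ℝ := qvar x c r 0 t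

/-- First time in `[a, t]` at which `x` satisfies the predicate `P` (`⊤` if there is none,
or if `a = ⊤`). -/
def hitTime (x : ℝ → ℝ) (t : ℝ) (a : EReal) (P : ℝ → Prop) : EReal :=
  sInf (Real.toEReal '' {u : ℝ | a ≤ (u : EReal) ∧ u ≤ t ∧ P (x u)})

/-- The pair `(σ_n, τ_n)` of crossing times of the interval `[z - c/2, z + c/2]` by `x`
on the time interval `[0, t]`: `σ_0 = 0`, `τ_n = inf{u ∈ [σ_n, t] : x u ≥ z + c/2}`,
`σ_{n+1} = inf{u ∈ [τ_n, t] : x u < z - c/2}`. -/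
def crossTimes (x : ℝ → ℝ) (z c t : ℝ) : ℕ → EReal × EReal
  | 0 => ((0 : EReal), hitTime x t (0 : EReal) (fun y => z + c / 2 ≤ y))
  | n + 1 =>
    let σ : EReal := hitTime x t (crossTimes x z c t n).2 (fun y => y < z - c / 2)
    (σ, hitTime x t σ (fun y => z + c / 2 ≤ y))

/-- The number of downcrossings `d_t^{z,c}(x) = max{n : σ_n ≤ t}`. -/
def downCross (x : ℝ → ℝ) (z c t : ℝ) : ℕ :=
  sSup {n : ℕ | (crossTimes x z c t n).1 ≤ (t : EReal)}

/-- The number of upcrossings `u_t^{z,c}(x) = d_t^{-z,c}(-x)`. -/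
def upCross (x : ℝ → ℝ) (z c t : ℝ) : ℕ :=
  downCross (fun u => -x u) (-z) c t

/-- The number of crossings by `x` of the interval `[z - c/2, z + c/2]` on `[0,t]`. -/
def crossCount (x : ℝ → ℝ) (z c t : ℝ) : ℕ :=
  upCross x z c t + downCross x z c t

/-- The normalization function `φ(c) = 1/(3^⌊-log₃ c⌋ (1 - (3/4) 3^⌊-log₃ c⌋ c))`. -/
def phiFn (c : ℝ) : ℝ :=
  1 / ((3 : ℝ) ^ (⌊-Real.logb 3 c⌋) * (1 - 3 / 4 * ((3 : ℝ) ^ (⌊-Real.logb 3 c⌋) * c)))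

/-- `n` successive passages from `P` to `Q` can be found at times in `[s, t]`. -/
def AltChain (P Q : ℝ → Prop) (s : ℝ) : ℕ → ℝ → Prop
  | 0, t => s ≤ t
  | n + 1, t => ∃ u v, AltChain P Q s n u ∧ P u ∧ u ≤ v ∧ Q v ∧ v ≤ t

/-- The maximal number of successive passages from `P` to `Q` during `[s, t]`. -/
def passCount (P Q : ℝ → Prop) (s t : ℝ) : ℕ := sSup {n | AltChain P Q s n t}

/-- Every passage from `P` to `Q` takes at least a fixed positive amount of time. -/
def Separated (P Q : ℝ → Prop) : Prop :=
  ∃ δ > 0, ∀ u v : ℝ, P u → Q v → u ≤ v → δ ≤ v - u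

namespace AltChain

variable {P Q : ℝ → Prop} {s t : ℝ}

theorem mono {n : ℕ} {r : ℝ} (h : AltChain P Q s n t) (htr : t ≤ r) : AltChain P Q s n r := by
  cases n with
  | zero => exact le_trans h htr
  | succ n =>
    obtain ⟨u, v, h1, h2, h3, h4, h5⟩ := h
    exact ⟨u, v, h1, h2, h3, h4, h5.trans htr⟩

theorem le {n : ℕ} (h : AltChain P Q s n t) : s ≤ t := by
  induction n generalizing t with
  | zero => exact h
  | succ n ih =>
    obtain ⟨u, v, h1, h2, h3, h4, h5⟩ := h
    exact (ih h1).trans (h3.trans h5)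

theorem of_le {m n : ℕ} (h : AltChain P Q s n t) (hmn : m ≤ n) : AltChain P Q s m t := by
  induction n, hmn using Nat.le_induction generalizing t with
  | base => exact h
  | succ n _ ih =>
    obtain ⟨u, v, h1, h2, h3, h4, h5⟩ := h
    exact ih (h1.mono (h3.trans h5))

theorem append {m n : ℕ} {r : ℝ} (h : AltChain P Q s m r) (h' : AltChain P Q r n t) :
    AltChain P Q s (m + n) t := by
  induction n generalizing t with
  | zero => exact h.mono h'
  | succ n ih =>
    obtain ⟨u, v, h1, h2, h3, h4, h5⟩ := h'
    exact ⟨u, v, ih h1, h2, h3, h4, h5⟩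

theorem split {n : ℕ} {r : ℝ} (h : AltChain P Q s n t) (hsr : s ≤ r) (hrt : r ≤ t) :
    ∃ i j, AltChain P Q s i r ∧ AltChain P Q r j t ∧ n ≤ i + j + 1 ∧
      (P r ∨ Q r → n ≤ i + j) := by
  induction n generalizing t with
  | zero => exact ⟨0, 0, hsr, hrt, by simp, by simp⟩
  | succ n ih =>
    obtain ⟨u, v, h1, h2, h3, h4, h5⟩ := h
    rcases le_total r u with hru | hur
    · obtain ⟨i, j, hi, hj, h6, h7⟩ := ih h1 hru
      exact ⟨i, j + 1, hi, ⟨u, v, hj, h2, h3, h4, h5⟩, by omega, fun h => by have := h7 h; omega⟩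
    · rcases le_total v r with hvr | hrv
      · exact ⟨n + 1, 0, ⟨u, v, h1, h2, h3, h4, hvr⟩, hrt, by omega, by omega⟩
      · by_cases hP : P r
        · exact ⟨n, 1, h1.mono hur, ⟨r, v, le_refl r, hP, hrv, h4, h5⟩, by omega, by omega⟩
        · by_cases hQ : Q r
          · exact ⟨n + 1, 0, ⟨u, r, h1, h2, hur, hQ, le_rfl⟩, hrt, by omega, by omega⟩
          · exact ⟨n, 0, h1.mono hur, hrt, by omega, by tauto⟩

theorem mul_le_sub {n : ℕ} {δ : ℝ} (hδ : ∀ u v : ℝ, P u → Q v → u ≤ v → δ ≤ v - u)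
    (h : AltChain P Q s n t) : n * δ ≤ t - s := by
  induction n generalizing t with
  | zero => simpa using h.le
  | succ n ih =>
    obtain ⟨u, v, h1, h2, h3, h4, h5⟩ := h
    have := ih h1
    have := hδ u v h2 h4 h3
    push_cast
    linarith

theorem imp {P' Q' : ℝ → Prop} {n : ℕ} (hP : ∀ u, s ≤ u → u ≤ t → P u → P' u)
    (hQ : ∀ u, s ≤ u → u ≤ t → Q u → Q' u) (h : AltChain P Q s n t) : AltChain P' Q' s n t := by
  induction n generalizing t with
  | zero => exact h
  | succ n ih =>
    obtain ⟨u, v, h1, h2, h3, h4, h5⟩ := h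
    refine ⟨u, v, ih (fun w h6 h7 => hP w h6 (by linarith)) (fun w h6 h7 => hQ w h6 (by linarith))
      h1, hP u h1.le (by linarith) h2, h3, hQ v (h1.le.trans h3) h5 h4, h5⟩

theorem map (e : ℝ ≃o ℝ) {n : ℕ} (h : AltChain (fun u => P (e u)) (fun u => Q (e u)) s n t) :
    AltChain P Q (e s) n (e t) := by
  induction n generalizing t with
  | zero => exact e.monotone h
  | succ n ih =>
    obtain ⟨u, v, h1, h2, h3, h4, h5⟩ := h
    exact ⟨e u, e v, ih h1, h2, e.monotone h3, h4, e.monotone h5⟩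

theorem map_iff (e : ℝ ≃o ℝ) {n : ℕ} :
    AltChain P Q (e s) n (e t) ↔ AltChain (fun u => P (e u)) (fun u => Q (e u)) s n t := by
  refine ⟨fun h => ?_, map e⟩
  have := map (P := fun u => P (e u)) (Q := fun u => Q (e u)) e.symm (s := e s) (t := e t) (n := n)
    (by simpa using h)
  simpa using this

end AltChain

section PassCount

variable {P Q : ℝ → Prop} {s r t : ℝ}

theorem passCount_congr {P' Q' : ℝ → Prop} (hP : ∀ u, s ≤ u → u ≤ t → (P u ↔ P' u))
    (hQ : ∀ u, s ≤ u → u ≤ t → (Q u ↔ Q' u)) : passCount P Q s t = passCount P' Q' s t := by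
  unfold passCount
  congr 1
  ext n
  exact ⟨AltChain.imp (fun u h h' => (hP u h h').1) (fun u h h' => (hQ u h h').1),
    AltChain.imp (fun u h h' => (hP u h h').2) (fun u h h' => (hQ u h h').2)⟩

theorem passCount_map (e : ℝ ≃o ℝ) : passCount P Q (e s) (e t) =
    passCount (fun u => P (e u)) (fun u => Q (e u)) s t := by
  simp only [passCount, AltChain.map_iff]

theorem Separated.le_passCount_iff (h : Separated P Q) (hst : s ≤ t) {n : ℕ} :
    n ≤ passCount P Q s t ↔ AltChain P Q s n t := by
  obtain ⟨δ, hδ, h⟩ := h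
  have hb : BddAbove {n | AltChain P Q s n t} := by
    refine ⟨⌊(t - s) / δ⌋₊, fun n hn => Nat.le_floor ?_⟩
    rw [le_div_iff₀ hδ]
    exact hn.mul_le_sub h
  refine ⟨fun hn => ?_, fun hn => le_csSup hb hn⟩
  have : passCount P Q s t ∈ {n | AltChain P Q s n t} := Nat.sSup_mem ⟨0, hst⟩ hb
  exact this.of_le hn

theorem Separated.passCount_mul_le {δ : ℝ} (hδ : 0 < δ)
    (h : ∀ u v : ℝ, P u → Q v → u ≤ v → δ ≤ v - u) (hst : s ≤ t) :
    passCount P Q s t * δ ≤ t - s :=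
  AltChain.mul_le_sub h ((Separated.le_passCount_iff ⟨δ, hδ, h⟩ hst).1 le_rfl)

theorem Separated.add_le (h : Separated P Q) (hsr : s ≤ r) (hrt : r ≤ t) :
    passCount P Q s r + passCount P Q r t ≤ passCount P Q s t := by
  rw [h.le_passCount_iff (hsr.trans hrt)]
  exact ((h.le_passCount_iff hsr).1 le_rfl).append ((h.le_passCount_iff hrt).1 le_rfl)

theorem Separated.le_add_one (h : Separated P Q) (hsr : s ≤ r) (hrt : r ≤ t) :
    passCount P Q s t ≤ passCount P Q s r + passCount P Q r t + 1 := by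
  obtain ⟨i, j, hi, hj, hij, -⟩ := ((h.le_passCount_iff (hsr.trans hrt)).1 le_rfl).split hsr hrt
  rw [← h.le_passCount_iff hsr] at hi
  rw [← h.le_passCount_iff hrt] at hj
  omega

theorem Separated.eq_add (h : Separated P Q) (hsr : s ≤ r) (hrt : r ≤ t) (hr : P r ∨ Q r) :
    passCount P Q s t = passCount P Q s r + passCount P Q r t := by
  refine le_antisymm ?_ (h.add_le hsr hrt)
  obtain ⟨i, j, hi, hj, -, hij⟩ := ((h.le_passCount_iff (hsr.trans hrt)).1 le_rfl).split hsr hrt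
  rw [← h.le_passCount_iff hsr] at hi
  rw [← h.le_passCount_iff hrt] at hj
  have := hij hr
  omega

theorem Separated.eq_zero (h : Separated P Q) (hst : s ≤ t)
    (hn : ∀ u v, s ≤ u → u ≤ v → v ≤ t → P u → Q v → False) : passCount P Q s t = 0 := by
  by_contra hne
  obtain ⟨u, v, h1, h2, h3, h4, h5⟩ :=
    (h.le_passCount_iff hst (n := 1)).1 (Nat.one_le_iff_ne_zero.2 hne)
  exact hn u v h1 h3 h5 h2 h4

theorem Separated.le_one (h : Separated P Q) (hst : s ≤ t)
    (hn : ∀ u v, s ≤ u → u ≤ v → v ≤ t → Q u → P v → False) : passCount P Q s t ≤ 1 := by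
  by_contra! hlt
  obtain ⟨u, v, ⟨u', v', h1', h2', h3', h4', h5'⟩, h2, h3, h4, h5⟩ :=
    (h.le_passCount_iff hst (n := 2)).1 hlt
  exact hn v' u (h1'.le.trans h3') h5' (h3.trans h5) h4' h2

theorem Separated.one_le (h : Separated P Q) (hst : s ≤ t) (hP : P s) (hQ : Q t) :
    1 ≤ passCount P Q s t :=
  (h.le_passCount_iff hst).2 ⟨s, t, le_refl s, hP, hst, hQ, le_rfl⟩

end PassCount

/-- The number of downcrossings of `[z - c/2, z + c/2]` by `f` during `[s, t]`. -/
def downs (f : ℝ → ℝ) (z c s t : ℝ) : ℕ :=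
  passCount (fun u => z + c / 2 ≤ f u) (fun u => f u < z - c / 2) s t

/-- The number of upcrossings of `[z - c/2, z + c/2]` by `f` during `[s, t]`. -/
def ups (f : ℝ → ℝ) (z c s t : ℝ) : ℕ :=
  passCount (fun u => f u ≤ z - c / 2) (fun u => z + c / 2 < f u) s t

/-- The number of crossings of `[z - c/2, z + c/2]` by `f` during `[s, t]`. -/
def crossings (f : ℝ → ℝ) (z c s t : ℝ) : ℕ := ups f z c s t + downs f z c s t

theorem ups_eq_downs_neg (f : ℝ → ℝ) (z c s t : ℝ) :
    ups f z c s t = downs (fun u => -f u) (-z) c s t := by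
  refine passCount_congr (fun u _ _ => ?_) (fun u _ _ => ?_) <;>
    constructor <;> intro h <;> linarith

theorem UniformContinuous.exists_separation {f : ℝ → ℝ} (hf : UniformContinuous f) {c : ℝ}
    (hc : 0 < c) : ∃ δ > 0, ∀ u v : ℝ, c ≤ |f u - f v| → u ≤ v → δ ≤ v - u := by
  obtain ⟨δ, hδ, h⟩ := Metric.uniformContinuous_iff.1 hf c hc
  refine ⟨δ, hδ, fun u v huv hle => ?_⟩
  by_contra! hlt
  have := @h u v (by rw [dist_comm, Real.dist_eq, abs_of_nonneg (by linarith)]; exact hlt)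
  rw [Real.dist_eq] at this
  linarith

theorem UniformContinuous.separated_downs {f : ℝ → ℝ} (hf : UniformContinuous f) {c : ℝ}
    (hc : 0 < c) (z : ℝ) :
    Separated (fun u => z + c / 2 ≤ f u) (fun u => f u < z - c / 2) := by
  obtain ⟨δ, hδ, h⟩ := hf.exists_separation hc
  exact ⟨δ, hδ, fun u v hu hv => h u v (le_trans (by linarith) (le_abs_self _))⟩

theorem UniformContinuous.separated_ups {f : ℝ → ℝ} (hf : UniformContinuous f) {c : ℝ}
    (hc : 0 < c) (z : ℝ) :
    Separated (fun u => f u ≤ z - c / 2) (fun u => z + c / 2 < f u) := by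
  obtain ⟨δ, hδ, h⟩ := hf.exists_separation hc
  exact ⟨δ, hδ, fun u v hu hv => h u v (le_trans (by linarith) (neg_abs_le _ |> neg_le.1))⟩

theorem UniformContinuous.exists_crossings_le {f : ℝ → ℝ} (hf : UniformContinuous f) {c : ℝ}
    (hc : 0 < c) {s t : ℝ} (hst : s ≤ t) : ∃ B : ℝ, ∀ z, (crossings f z c s t : ℝ) ≤ B := by
  obtain ⟨δ, hδ, h⟩ := hf.exists_separation hc
  refine ⟨(t - s) / δ + (t - s) / δ, fun z => ?_⟩
  rw [crossings, Nat.cast_add]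
  refine add_le_add ?_ ?_ <;> rw [le_div_iff₀ hδ] <;>
    refine Separated.passCount_mul_le hδ (fun u v hu hv => h u v ?_) hst
  · exact le_trans (by linarith) (neg_abs_le _ |> neg_le.1)
  · exact le_trans (by linarith) (le_abs_self _)

theorem crossings_add_le {f : ℝ → ℝ} (hf : UniformContinuous f) {c : ℝ} (hc : 0 < c) (z : ℝ)
    {s r t : ℝ} (hsr : s ≤ r) (hrt : r ≤ t) :
    crossings f z c s r + crossings f z c r t ≤ crossings f z c s t := by
  have h1 := (hf.separated_ups hc z).add_le hsr hrt
  have h2 := (hf.separated_downs hc z).add_le hsr hrt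
  simp only [crossings, ups, downs]
  omega

theorem crossings_le_add {f : ℝ → ℝ} (hf : UniformContinuous f) {c : ℝ} (hc : 0 < c) (z : ℝ)
    {s r t : ℝ} (hsr : s ≤ r) (hrt : r ≤ t) :
    crossings f z c s t ≤ crossings f z c s r + crossings f z c r t + 2 := by
  have h1 := (hf.separated_ups hc z).le_add_one hsr hrt
  have h2 := (hf.separated_downs hc z).le_add_one hsr hrt
  simp only [crossings, ups, downs]
  omega

theorem crossings_eq_add {f : ℝ → ℝ} (hf : UniformContinuous f) {c : ℝ} (hc : 0 < c) {z : ℝ}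
    {s r t : ℝ} (hsr : s ≤ r) (hrt : r ≤ t) (hr : c / 2 < |f r - z|) :
    crossings f z c s t = crossings f z c s r + crossings f z c r t := by
  rw [lt_abs] at hr
  have h1 := (hf.separated_ups hc z).eq_add hsr hrt
    (hr.symm.imp (fun h => by linarith) (fun h => by linarith))
  have h2 := (hf.separated_downs hc z).eq_add hsr hrt
    (hr.imp (fun h => by linarith) (fun h => by linarith))
  simp only [crossings, ups, downs]
  omega

theorem crossings_eq_zero {f : ℝ → ℝ} (hf : UniformContinuous f) {c : ℝ} (hc : 0 < c) {z : ℝ}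
    {s t : ℝ} (hst : s ≤ t) (h : (∀ u, s ≤ u → u ≤ t → z - c / 2 < f u) ∨
      ∀ u, s ≤ u → u ≤ t → f u < z + c / 2) :
    crossings f z c s t = 0 := by
  have h1 := (hf.separated_ups hc z).eq_zero hst (fun u v hu huv hv hP hQ => by
    rcases h with h | h
    · linarith [h u hu (huv.trans hv)]
    · linarith [h v (hu.trans huv) hv])
  have h2 := (hf.separated_downs hc z).eq_zero hst (fun u v hu huv hv hP hQ => by
    rcases h with h | h
    · linarith [h v (hu.trans huv) hv]
    · linarith [h u hu (huv.trans hv)])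
  simp only [crossings, ups, downs]
  omega

theorem crossings_eq_one {f : ℝ → ℝ} (hf : UniformContinuous f) {c : ℝ} (hc : 0 < c) {z : ℝ}
    {s t : ℝ} (hst : s ≤ t) (hs : f s ≤ z - c / 2) (ht : z + c / 2 < f t)
    (h : ∀ u v, s ≤ u → u ≤ v → v ≤ t → z + c / 2 ≤ f u → z - c / 2 < f v) :
    crossings f z c s t = 1 := by
  have h1 := (hf.separated_ups hc z).one_le hst hs ht
  have h2 := (hf.separated_ups hc z).le_one hst (fun u v hu huv hv hP hQ => by
    linarith [h u v hu huv hv hP.le])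
  have h3 := (hf.separated_downs hc z).eq_zero hst (fun u v hu huv hv hP hQ => by
    linarith [h u v hu huv hv hP])
  simp only [crossings, ups, downs]
  omega

theorem measurableSet_of_left_nhds {S : Set ℝ} (h : ∀ z ∈ S, ∃ w < z, Set.Ioc w z ⊆ S) :
    MeasurableSet S := by
  have hc : (S \ interior S).Countable := by
    refine (countable_setOfPred_isolated_left_within (s := S \ interior S)).mono fun z hz => ?_
    refine ⟨hz, ?_⟩
    obtain ⟨w, hw, hwz⟩ := h z hz.1
    have hsub : Set.Ioo w z ⊆ interior S :=
      interior_maximal (Set.Ioo_subset_Ioc_self.trans hwz) isOpen_Ioo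
    rw [← Filter.empty_mem_iff_bot]
    refine Filter.mem_of_superset (Filter.inter_mem self_mem_nhdsWithin
      (mem_nhdsWithin_of_mem_nhds (Ioi_mem_nhds hw))) ?_
    rintro y ⟨⟨hy1, hy2⟩, hy3⟩
    exact hy1.2 (hsub ⟨hy3, hy2⟩)
  have : S = interior S ∪ (S \ interior S) := (Set.union_sdiff_cancel interior_subset).symm
  rw [this]
  exact isOpen_interior.measurableSet.union hc.measurableSet

theorem measurable_downs {f : ℝ → ℝ} (hf : UniformContinuous f) {c : ℝ} (hc : 0 < c) {s t : ℝ}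
    (hst : s ≤ t) : Measurable fun z => downs f z c s t := by
  refine measurable_of_Ici fun n => ?_
  have key : ∀ (n : ℕ) (t z : ℝ),
      AltChain (fun u => z + c / 2 ≤ f u) (fun u => f u < z - c / 2) s n t →
      ∃ w < z, ∀ y ∈ Set.Ioc w z,
        AltChain (fun u => y + c / 2 ≤ f u) (fun u => f u < y - c / 2) s n t := by
    intro n
    induction n with
    | zero => exact fun t z h => ⟨z - 1, by linarith, fun y _ => h⟩
    | succ n ih =>
      rintro t z ⟨u, v, h1, h2, h3, h4, h5⟩
      obtain ⟨w, hw, h⟩ := ih u z h1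
      refine ⟨max w (f v + c / 2), max_lt hw (by linarith), fun y hy => ?_⟩
      have hy1 := max_lt_iff.1 hy.1
      exact ⟨u, v, h y ⟨hy1.1, hy.2⟩, by linarith [hy.2], h3, by linarith [hy1.2], h5⟩
  refine measurableSet_of_left_nhds fun z hz => ?_
  have hz' : n ≤ downs f z c s t := hz
  rw [downs, (hf.separated_downs hc z).le_passCount_iff hst] at hz'
  obtain ⟨w, hw, h⟩ := key n t z hz'
  exact ⟨w, hw, fun y hy => ((hf.separated_downs hc y).le_passCount_iff hst).2 (h y hy)⟩

theorem measurable_crossings {f : ℝ → ℝ} (hf : UniformContinuous f) {c : ℝ} (hc : 0 < c) {s t : ℝ}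
    (hst : s ≤ t) : Measurable fun z => (crossings f z c s t : ℝ) := by
  have h1 : Measurable fun z => ups f z c s t := by
    simp only [ups_eq_downs_neg]
    exact (measurable_downs hf.neg hc hst).comp measurable_neg
  exact measurable_from_nat.comp (h1.add (measurable_downs hf hc hst))

theorem exists_lt_of_hitTime_le {f : ℝ → ℝ} (hf : Continuous f) {t v : ℝ} {a : EReal}
    {P : ℝ → Prop} (hP : ∀ᶠ y in nhds (f v), ¬ P y) (h : hitTime f t a P ≤ (v : EReal)) :
    ∃ u < v, a ≤ (u : EReal) ∧ u ≤ t ∧ P (f u) := by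
  by_contra! hne
  obtain ⟨δ, hδ, hb⟩ := Metric.eventually_nhds_iff.1 (hf.continuousAt.eventually hP)
  have : ((v + δ : ℝ) : EReal) ≤ hitTime f t a P := by
    refine le_sInf ?_
    rintro _ ⟨u, ⟨h1, h2, h3⟩, rfl⟩
    rw [EReal.coe_le_coe_iff]
    by_contra! hlt
    rcases lt_or_ge u v with huv | hvu
    · exact hne u huv h1 h2 h3
    · refine hb (y := u) ?_ h3
      rw [Real.dist_eq, abs_of_nonneg (by linarith)]
      linarith
  have := this.trans h
  rw [EReal.coe_le_coe_iff] at this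
  linarith

theorem hitTime_le {f : ℝ → ℝ} {t u : ℝ} {a : EReal} {P : ℝ → Prop} (h1 : a ≤ (u : EReal))
    (h2 : u ≤ t) (h3 : P (f u)) : hitTime f t a P ≤ (u : EReal) :=
  sInf_le ⟨u, ⟨h1, h2, h3⟩, rfl⟩

theorem crossTimes_le_iff {f : ℝ → ℝ} (hf : Continuous f) {z c t : ℝ} (hc : 0 < c) (ht : 0 ≤ t)
    (n : ℕ) : (crossTimes f z c t n).1 ≤ (t : EReal) ↔
      AltChain (fun u => z + c / 2 ≤ f u) (fun u => f u < z - c / 2) 0 n t := by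
  have fwd : ∀ n u, u ≤ t → z + c / 2 ≤ f u → (crossTimes f z c t n).1 ≤ (u : EReal) →
      AltChain (fun u => z + c / 2 ≤ f u) (fun u => f u < z - c / 2) 0 n u := by
    intro n
    induction n with
    | zero =>
      intro u _ _ h
      simpa [crossTimes, AltChain] using h
    | succ n ih =>
      intro v' hv't hv' h
      obtain ⟨v, hv, h1, h2, h3⟩ := exists_lt_of_hitTime_le hf
        ((lt_mem_nhds (show z - c / 2 < f v' by linarith)).mono fun y hy => not_lt.2 hy.le) h
      have h1' : hitTime f t (crossTimes f z c t n).1 (fun y => z + c / 2 ≤ y) ≤ (v : EReal) := by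
        cases n <;> exact h1
      obtain ⟨u, hu, h4, h5, h6⟩ := exists_lt_of_hitTime_le hf
        ((gt_mem_nhds (show f v < z + c / 2 by linarith)).mono fun y hy => not_le.2 hy) h1'
      exact ⟨u, v, ih u h5 h6 h4, h6, hu.le, h3, hv.le⟩
  have bwd : ∀ n u, u ≤ t →
      AltChain (fun u => z + c / 2 ≤ f u) (fun u => f u < z - c / 2) 0 n u →
      (crossTimes f z c t n).1 ≤ (u : EReal) := by
    intro n
    induction n with
    | zero =>
      intro u _ h
      simpa [crossTimes, AltChain] using h
    | succ n ih =>
      rintro w hw ⟨u, v, h1, h2, h3, h4, h5⟩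
      have hτ : (crossTimes f z c t n).2 ≤ (v : EReal) := by
        have : hitTime f t (crossTimes f z c t n).1 (fun y => z + c / 2 ≤ y) ≤ (v : EReal) :=
          (hitTime_le (ih u (by linarith) h1) (by linarith) h2).trans (EReal.coe_le_coe_iff.2 h3)
        cases n <;> exact this
      have : (crossTimes f z c t (n + 1)).1 ≤ (v : EReal) :=
        hitTime_le (f := f) (P := fun y => y < z - c / 2) hτ (by linarith) h4
      exact this.trans (EReal.coe_le_coe_iff.2 h5)
  refine ⟨fun h => ?_, bwd n t le_rfl⟩
  cases n with
  | zero => exact ht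
  | succ n =>
    have hne : ∃ v : ℝ, (crossTimes f z c t n).2 ≤ (v : EReal) ∧ v ≤ t ∧ f v < z - c / 2 := by
      by_contra! hno
      have : (crossTimes f z c t (n + 1)).1 = ⊤ := by
        refine sInf_eq_top.2 ?_
        rintro _ ⟨u, ⟨h1, h2, h3⟩, rfl⟩
        exact absurd h3 (not_lt.2 (hno u h1 h2))
      rw [this, top_le_iff] at h
      exact EReal.coe_ne_top _ h
    obtain ⟨v, h1, h2, h3⟩ := hne
    have h1' : hitTime f t (crossTimes f z c t n).1 (fun y => z + c / 2 ≤ y) ≤ (v : EReal) := by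
      cases n <;> exact h1
    obtain ⟨u, hu, h4, h5, h6⟩ := exists_lt_of_hitTime_le hf
      ((gt_mem_nhds (show f v < z + c / 2 by linarith)).mono fun y hy => not_le.2 hy) h1'
    exact ⟨u, v, fwd n u h5 h6 h4, h6, hu.le, h3, h2⟩

theorem downCross_eq {f : ℝ → ℝ} (hf : Continuous f) {z c t : ℝ} (hc : 0 < c) (ht : 0 ≤ t) :
    downCross f z c t = downs f z c 0 t := by
  simp only [downCross, downs, passCount, crossTimes_le_iff hf hc ht]

theorem crossCount_eq {f : ℝ → ℝ} (hf : Continuous f) {z c t : ℝ} (hc : 0 < c) (ht : 0 ≤ t) :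
    crossCount f z c t = crossings f z c 0 t := by
  rw [crossCount, upCross, downCross_eq hf hc ht, downCross_eq (f := fun u => -f u) hf.neg hc ht,
    crossings, ups_eq_downs_neg]

/-- The affine map by which the Peano curve's horizontal component on the `l`-th of nine equal
time intervals is obtained from the whole. -/
def cellMap (l : ℕ) (z : ℝ) : ℝ := (((l / 3 : ℕ) : ℝ) + if l % 3 = 1 then 1 - z else z) / 3

/-- The properties of the horizontal component of the Peano curve used below. -/
structure SelfSimilarCurve (f : ℝ → ℝ) : Prop where
  uc : UniformContinuous f
  mem : ∀ t, f t ∈ Set.Icc (0 : ℝ) 1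
  cell : ∀ l : ℕ, l < 9 → ∀ t ∈ Set.Icc (0 : ℝ) 1, f ((l + t) / 9) = cellMap l (f t)

theorem peanoXDigit_lt (d : ℕ → Fin 3) (m : ℕ) : peanoXDigit d m < 3 := by
  have h : ∀ n v : ℕ, v < 3 → peanoK^[n] v < 3 := by
    intro n
    induction n with
    | zero => exact fun v hv => hv
    | succ n ih => exact fun v _ => ih _ (by simp only [peanoK]; omega)
  exact h _ _ (d (2 * m)).isLt

/-- The digit sequence of the horizontal component of the Peano curve. -/
def peanoDigits (d : ℕ → Fin 3) : ℕ → Fin 3 := fun m => ⟨peanoXDigit d m, peanoXDigit_lt d m⟩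

theorem continuous_peanoDigits : Continuous peanoDigits := by
  refine continuous_pi fun m => ?_
  have hk : ∀ n (v : Fin 3), peanoK^[n] (v : ℕ) < 3 := fun n v => by
    induction n with
    | zero => exact v.isLt
    | succ n ih => rw [Function.iterate_succ_apply']; simp only [peanoK]; omega
  let F : ℕ × Fin 3 → Fin 3 := fun p => ⟨peanoK^[p.1] (p.2 : ℕ), hk _ _⟩
  have hF : Continuous F := continuous_of_discreteTopology
  have hval : Continuous fun v : Fin 3 => (v : ℕ) := continuous_of_discreteTopology
  exact hF.comp (g := F) ((continuous_finsetSum (Finset.range m)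
    fun i _ => hval.comp (continuous_apply (2 * i + 1))).prodMk (continuous_apply (2 * m)))

theorem ofDigits_three (d : ℕ → Fin 3) :
    Real.ofDigits d = ∑' j : ℕ, (d j : ℝ) / 3 ^ (j + 1) := by
  simp only [Real.ofDigits, Real.ofDigitsTerm, div_eq_mul_inv, Nat.cast_ofNat]

theorem IsPeanoX.apply_ofDigits {x : ℝ → ℝ} (hx : IsPeanoX x) (d : ℕ → Fin 3) :
    x (Real.ofDigits d) = Real.ofDigits (peanoDigits d) := by
  rw [ofDigits_three, ofDigits_three]
  exact hx d

theorem exists_ofDigits_eq {t : ℝ} (ht : t ∈ Set.Icc (0 : ℝ) 1) :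
    ∃ d : ℕ → Fin 3, Real.ofDigits d = t := by
  obtain ⟨d, -, hd⟩ := Real.ofDigits_SurjOn (b := 3) (by norm_num) ht
  exact ⟨d, hd⟩

theorem ofDigits_rev (d : ℕ → Fin 3) :
    Real.ofDigits (fun m => (d m).rev) = 1 - Real.ofDigits d := by
  have h2 := Real.ofDigits_const_last_eq_one 2
  rw [eq_sub_iff_add_eq, ← h2]
  simp only [Real.ofDigits]
  rw [← Real.summable_ofDigitsTerm.tsum_add Real.summable_ofDigitsTerm]
  congr 1
  ext m
  simp only [Real.ofDigitsTerm, ← add_mul]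
  congr 1
  have : ((d m).rev : ℕ) + (d m : ℕ) = 2 := by rw [Fin.val_rev]; omega
  exact_mod_cast this

theorem peanoK_iterate (b v : ℕ) (hb : b < 3) (hv : v < 3) :
    peanoK^[b] v = if b = 1 then 2 - v else v := by
  interval_cases b <;> simp [peanoK]
  omega

theorem IsPeanoX.apply_cell {x : ℝ → ℝ} (hx : IsPeanoX x) {l : ℕ} (hl : l < 9) {t : ℝ}
    (ht : t ∈ Set.Icc (0 : ℝ) 1) : x ((l + t) / 9) = cellMap l (x t) := by
  obtain ⟨d, rfl⟩ := exists_ofDigits_eq ht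
  let e : ℕ → Fin 3 := fun n => match n with
    | 0 => ⟨l / 3, by omega⟩
    | 1 => ⟨l % 3, by omega⟩
    | n + 2 => d n
  have he : Real.ofDigits e = (l + Real.ofDigits d) / 9 := by
    rw [Real.ofDigits_eq_sum_add_ofDigits e 2]
    have h1 : (fun i => e (i + 2)) = d := rfl
    have h2 : (l : ℝ) = 3 * ((l / 3 : ℕ) : ℝ) + ((l % 3 : ℕ) : ℝ) := by
      exact_mod_cast (Nat.div_add_mod l 3).symm
    rw [h1, Finset.sum_range_succ, Finset.sum_range_one, h2]
    simp only [Real.ofDigitsTerm, e]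
    push_cast
    ring
  have hs : ∀ m, peanoDigits e (m + 1) =
      if l % 3 = 1 then (peanoDigits d m).rev else peanoDigits d m := by
    intro m
    have h : peanoXDigit e (m + 1) = peanoK^[l % 3] (peanoXDigit d m) := by
      simp only [peanoXDigit]
      rw [Finset.sum_range_succ', Nat.add_comm, Function.iterate_add_apply]
      rfl
    rw [peanoK_iterate _ _ (by omega) (peanoXDigit_lt d m)] at h
    have := peanoXDigit_lt d m
    apply Fin.ext
    split_ifs with h1
    · simp only [h1, if_true] at h
      rw [Fin.val_rev]
      simp only [peanoDigits, h]
      omega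
    · simp only [h1, if_false] at h
      exact h
  rw [← he, hx.apply_ofDigits, hx.apply_ofDigits, Real.ofDigits_eq_sum_add_ofDigits _ 1]
  have h0 : (peanoDigits e 0 : ℕ) = l / 3 := by simp [peanoDigits, peanoXDigit, e]
  rw [Finset.sum_range_one, Real.ofDigitsTerm, h0, funext hs, cellMap]
  split_ifs with h1
  · rw [ofDigits_rev]
    push_cast
    ring
  · push_cast
    ring

theorem IsPeanoX.mem_Icc {x : ℝ → ℝ} (hx : IsPeanoX x) {t : ℝ} (ht : t ∈ Set.Icc (0 : ℝ) 1) :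
    x t ∈ Set.Icc (0 : ℝ) 1 := by
  obtain ⟨d, rfl⟩ := exists_ofDigits_eq ht
  rw [hx.apply_ofDigits]
  exact ⟨Real.ofDigits_nonneg _, Real.ofDigits_le_one _⟩

theorem IsPeanoX.continuous_restrict {x : ℝ → ℝ} (hx : IsPeanoX x) :
    Continuous fun t : Set.Icc (0 : ℝ) 1 => x t := by
  let π : (ℕ → Fin 3) → Set.Icc (0 : ℝ) 1 := fun d =>
    ⟨Real.ofDigits d, Real.ofDigits_nonneg _, Real.ofDigits_le_one _⟩
  have hπ : Continuous π := Real.continuous_ofDigits.subtype_mk _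
  have hq : Topology.IsQuotientMap π := by
    refine Topology.IsQuotientMap.of_surjective_continuous (fun t => ?_) hπ
    obtain ⟨d, hd⟩ := exists_ofDigits_eq t.2
    exact ⟨d, Subtype.ext hd⟩
  rw [hq.continuous_iff]
  have : (fun t : Set.Icc (0 : ℝ) 1 => x t) ∘ π = fun d => Real.ofDigits (peanoDigits d) :=
    funext fun d => hx.apply_ofDigits d
  rw [this]
  exact Real.continuous_ofDigits.comp continuous_peanoDigits

theorem IsPeanoX.exists_selfSimilarCurve {x : ℝ → ℝ} (hx : IsPeanoX x) :
    ∃ f, SelfSimilarCurve f ∧ ∀ t ∈ Set.Icc (0 : ℝ) 1, f t = x t := by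
  have hfx : ∀ t ∈ Set.Icc (0 : ℝ) 1,
      Set.IccExtend zero_le_one (fun t : Set.Icc (0 : ℝ) 1 => x t) t = x t :=
    fun t ht => Set.IccExtend_of_mem _ _ ht
  refine ⟨Set.IccExtend zero_le_one (fun t : Set.Icc (0 : ℝ) 1 => x t), ⟨?_, ?_, ?_⟩, hfx⟩
  · exact (CompactSpace.uniformContinuous_of_continuous hx.continuous_restrict).comp
      (LipschitzWith.projIcc _).uniformContinuous
  · exact fun t => hx.mem_Icc (Set.projIcc (0 : ℝ) 1 zero_le_one t).2
  · intro l hl t ht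
    have hl' : (l : ℝ) ≤ 8 := by exact_mod_cast Nat.lt_succ_iff.1 hl
    rw [hfx t ht, hfx _ ⟨by have := ht.1; positivity, by linarith [ht.2]⟩, hx.apply_cell hl ht]

theorem phiFn_scale {c : ℝ} (hc : 0 < c) : phiFn (3 * c) = 3 * phiFn c := by
  have h : ⌊-Real.logb 3 (3 * c)⌋ = ⌊-Real.logb 3 c⌋ - 1 := by
    rw [Real.logb_mul (by norm_num) hc.ne', Real.logb_self_eq_one (by norm_num), neg_add_rev,
      ← sub_eq_add_neg, Int.floor_sub_one]
  rw [phiFn, phiFn, h, zpow_sub_one₀ (by norm_num)]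
  rw [show (3 : ℝ) ^ ⌊-Real.logb 3 c⌋ * 3⁻¹ * (3 * c) = (3 : ℝ) ^ ⌊-Real.logb 3 c⌋ * c by ring,
    mul_right_comm, one_div, one_div, mul_inv, mul_inv, inv_inv]
  ring

theorem zpow_floor_mul_mem {c : ℝ} (hc : 0 < c) :
    (3 : ℝ) ^ ⌊-Real.logb 3 c⌋ * c ∈ Set.Ioc (1 / 3 : ℝ) 1 := by
  have hc3 : (3 : ℝ) ^ (-Real.logb 3 c) = c⁻¹ := by
    rw [Real.rpow_neg (by norm_num), Real.rpow_logb (by norm_num) (by norm_num) hc]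
  have h1 : (3 : ℝ) ^ ⌊-Real.logb 3 c⌋ ≤ c⁻¹ := by
    rw [← hc3, ← Real.rpow_intCast]
    exact Real.rpow_le_rpow_of_exponent_le (by norm_num) (Int.floor_le _)
  have h2 : c⁻¹ < (3 : ℝ) ^ ⌊-Real.logb 3 c⌋ * 3 := by
    rw [← hc3, ← zpow_add_one₀ (by norm_num), ← Real.rpow_intCast]
    refine Real.rpow_lt_rpow_of_exponent_lt (by norm_num) ?_
    push_cast
    exact Int.lt_floor_add_one _
  constructor
  · have := mul_lt_mul_of_pos_right h2 hc
    rw [inv_mul_cancel₀ hc.ne'] at this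
    linarith
  · have := mul_le_mul_of_nonneg_right h1 hc.le
    rwa [inv_mul_cancel₀ hc.ne'] at this

theorem phiFn_pos {c : ℝ} (hc : 0 < c) : 0 < phiFn c := by
  have h := zpow_floor_mul_mem hc
  have h1 : 0 < 1 - 3 / 4 * ((3 : ℝ) ^ ⌊-Real.logb 3 c⌋ * c) := by linarith [h.2]
  rw [phiFn]
  positivity

theorem phiFn_le {c : ℝ} (hc : 0 < c) : phiFn c ≤ 12 * c := by
  have h := zpow_floor_mul_mem hc
  rw [phiFn]
  have h3 : 0 < (3 : ℝ) ^ ⌊-Real.logb 3 c⌋ := by positivity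
  generalize (3 : ℝ) ^ ⌊-Real.logb 3 c⌋ = q at *
  have h1 : 1 / 4 ≤ 1 - 3 / 4 * (q * c) := by linarith [h.2]
  rw [div_le_iff₀ (by nlinarith)]
  nlinarith [h.1, mul_le_mul_of_nonneg_left h1 (mul_pos h3 hc).le]

theorem inv_phiFn_of_mem {c : ℝ} (hc : c ∈ Set.Ioc (1 / 3 : ℝ) 1) :
    (phiFn c)⁻¹ = 1 - 3 / 4 * c := by
  have hc0 : 0 < c := by linarith [hc.1]
  have h : ⌊-Real.logb 3 c⌋ = 0 := by
    rw [Int.floor_eq_zero_iff]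
    constructor
    · have := Real.logb_nonpos (b := 3) (by norm_num) hc0.le hc.2
      linarith
    · have := Real.logb_lt_logb (b := 3) (by norm_num) (by norm_num) hc.1
      rw [one_div, Real.logb_inv, Real.logb_self_eq_one (by norm_num)] at this
      linarith
  rw [phiFn, h]
  simp

theorem tendsto_phiFn : Tendsto phiFn (nhdsWithin 0 (Set.Ioi 0)) (nhds 0) := by
  have h : Tendsto (fun c : ℝ => 12 * c) (nhdsWithin 0 (Set.Ioi 0)) (nhds 0) := by
    have : Tendsto (fun c : ℝ => 12 * c) (nhds 0) (nhds (12 * 0)) :=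
      (continuous_const_mul 12).tendsto 0
    rw [mul_zero] at this
    exact this.mono_left nhdsWithin_le_nhds
  refine tendsto_of_tendsto_of_tendsto_of_le_of_le' tendsto_const_nhds h ?_ ?_
  · filter_upwards [self_mem_nhdsWithin] with c hc using (phiFn_pos hc).le
  · filter_upwards [self_mem_nhdsWithin] with c hc using phiFn_le hc

theorem continuous_cellMap (l : ℕ) : Continuous (cellMap l) := by
  unfold cellMap
  split_ifs <;> fun_prop

theorem cellMap_mem {l : ℕ} {z : ℝ} (hz : z ∈ Set.Icc (0 : ℝ) 1) :
    cellMap l z ∈ Set.Icc (((l / 3 : ℕ) : ℝ) / 3) ((((l / 3 : ℕ) : ℝ) + 1) / 3) := by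
  have := hz.1
  have := hz.2
  unfold cellMap
  constructor <;> gcongr <;> split_ifs <;> linarith

theorem cellMap_mem_unit {l : ℕ} (hl : l < 9) {z : ℝ} (hz : z ∈ Set.Icc (0 : ℝ) 1) :
    cellMap l z ∈ Set.Icc (0 : ℝ) 1 := by
  have h := cellMap_mem (l := l) hz
  have h2 : ((l / 3 : ℕ) : ℝ) ≤ 2 := by exact_mod_cast (by omega : l / 3 ≤ 2)
  exact ⟨le_trans (by positivity) h.1, by linarith [h.2]⟩

theorem abs_cellMap_sub (l : ℕ) (y z : ℝ) : |cellMap l y - cellMap l z| = |y - z| / 3 := by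
  have h3 : |y - z| / 3 = |(y - z) / 3| := by rw [abs_div, abs_of_pos (by norm_num : (0 : ℝ) < 3)]
  rw [h3]
  unfold cellMap
  split_ifs
  · rw [← abs_neg]
    congr 1
    ring
  · congr 1
    ring

theorem integral_comp_cellMap (l : ℕ) (h : ℝ → ℝ) :
    ∫ z, h (cellMap l z) = 3 * ∫ z, h z := by
  have key : ∀ p q : ℝ, |q| = 1 / 3 → (∫ z, h (p + q * z)) = 3 * ∫ z, h z := by
    intro p q hq
    have h1 := MeasureTheory.Measure.integral_comp_mul_left (fun y => h (p + y)) q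
    rw [MeasureTheory.integral_add_left_eq_self] at h1
    rw [h1, abs_inv, hq]
    norm_num
  unfold cellMap
  split_ifs
  · rw [← key (((l / 3 : ℕ) + 1) / 3) (-1 / 3) (by norm_num [abs_div])]
    congr 1
    ext z
    congr 1
    ring
  · rw [← key ((l / 3 : ℕ) / 3) (1 / 3) (by norm_num [abs_div])]
    congr 1
    ext z
    congr 1
    ring

theorem exists_cell {t : ℝ} (ht : t ∈ Set.Icc (0 : ℝ) 1) :
    ∃ l : ℕ, l < 9 ∧ ∃ r ∈ Set.Icc (0 : ℝ) 1, t = (l + r) / 9 := by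
  rcases eq_or_lt_of_le ht.2 with rfl | h1
  · exact ⟨8, by norm_num, 1, by simp, by norm_num⟩
  · have h0 : 0 ≤ 9 * t := by linarith [ht.1]
    refine ⟨⌊9 * t⌋₊, (Nat.floor_lt h0).2 (by push_cast; linarith), 9 * t - ⌊9 * t⌋₊, ?_, by ring⟩
    exact ⟨sub_nonneg.2 (Nat.floor_le h0), by linarith [Nat.lt_floor_add_one (9 * t)]⟩

namespace SelfSimilarCurve

variable {f : ℝ → ℝ}

theorem apply_zero (hf : SelfSimilarCurve f) : f 0 = 0 := by
  have := hf.cell 0 (by norm_num) 0 (by simp)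
  norm_num [cellMap] at this
  linarith

theorem apply_one (hf : SelfSimilarCurve f) : f 1 = 1 := by
  have := hf.cell 8 (by norm_num) 1 (by simp)
  norm_num [cellMap] at this
  linarith

theorem cell_mem (hf : SelfSimilarCurve f) {l : ℕ} (hl : l < 9) {u : ℝ} (h0 : (l : ℝ) / 9 ≤ u)
    (h1 : u ≤ (l + 1) / 9) :
    f u ∈ Set.Icc (((l / 3 : ℕ) : ℝ) / 3) ((((l / 3 : ℕ) : ℝ) + 1) / 3) := by
  have h : u = (l + (9 * u - l)) / 9 := by ring
  rw [h, hf.cell l hl _ ⟨by linarith, by linarith⟩]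
  exact cellMap_mem (hf.mem _)

theorem column_mem (hf : SelfSimilarCurve f) {j : ℕ} (hj : j < 3) {u : ℝ} (h0 : (j : ℝ) / 3 ≤ u)
    (h1 : u ≤ (j + 1) / 3) : f u ∈ Set.Icc ((j : ℝ) / 3) ((j + 1) / 3) := by
  have key : ∀ r : ℕ, r < 3 → (3 * j + r : ℝ) / 9 ≤ u → u ≤ (3 * j + r + 1) / 9 →
      f u ∈ Set.Icc ((j : ℝ) / 3) ((j + 1) / 3) := by
    intro r hr h2 h3
    have := hf.cell_mem (l := 3 * j + r) (by omega) (by push_cast; exact h2)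
      (by push_cast; exact h3)
    rwa [show (3 * j + r) / 3 = j by omega] at this
  rcases le_total u ((3 * j + 1) / 9) with h2 | h2
  · exact key 0 (by norm_num) (by push_cast; linarith) (by push_cast; linarith)
  · rcases le_total u ((3 * j + 2) / 9) with h3 | h3
    · exact key 1 (by norm_num) (by push_cast; linarith) (by push_cast; linarith)
    · exact key 2 (by norm_num) (by push_cast; linarith) (by push_cast; linarith)

theorem le_grid (hf : SelfSimilarCurve f) {j : ℕ} (hj : j ≤ 3) {u : ℝ} (h0 : 0 ≤ u)
    (h1 : u ≤ (j : ℝ) / 3) : f u ≤ (j : ℝ) / 3 := by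
  induction j with
  | zero =>
    have : u = 0 := le_antisymm (by simpa using h1) h0
    simp [this, hf.apply_zero]
  | succ j ih =>
    rcases le_total u ((j : ℝ) / 3) with h2 | h2
    · refine (ih (by omega) h2).trans ?_
      push_cast
      linarith
    · push_cast at h1 ⊢
      exact (hf.column_mem (by omega) h2 h1).2

theorem grid_le (hf : SelfSimilarCurve f) {j : ℕ} (hj : j ≤ 3) {u : ℝ} (h0 : (j : ℝ) / 3 ≤ u)
    (h1 : u ≤ 1) : (j : ℝ) / 3 ≤ f u := by
  induction hj using Nat.decreasingInduction with
  | self =>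
    have : u = 1 := le_antisymm h1 (by norm_num at h0; exact h0)
    rw [this, hf.apply_one]
    norm_num
  | of_succ j hj ih =>
    rcases le_total u (((j + 1 : ℕ) : ℝ) / 3) with h2 | h2
    · push_cast at h2
      exact (hf.column_mem (by omega) h0 h2).1
    · refine le_trans ?_ (ih h2)
      push_cast
      linarith

theorem le_add_third (hf : SelfSimilarCurve f) {u v : ℝ} (hu : 0 ≤ u) (huv : u ≤ v) (hv : v ≤ 1) :
    f u ≤ f v + 1 / 3 := by
  have key : ∀ j : ℕ, j < 3 → (j : ℝ) / 3 ≤ u → u ≤ ((j + 1 : ℕ) : ℝ) / 3 → f u ≤ f v + 1 / 3 := by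
    intro j hj h0 h1
    have h2 := hf.le_grid (j := j + 1) (by omega) hu h1
    have h3 := hf.grid_le (j := j) (by omega) (h0.trans huv) hv
    push_cast at h2
    linarith
  rcases le_total u (1 / 3) with h | h
  · exact key 0 (by norm_num) (by simpa using hu) (by norm_num; linarith)
  · rcases le_total u (2 / 3) with h' | h'
    · exact key 1 (by norm_num) (by push_cast; linarith) (by push_cast; linarith)
    · exact key 2 (by norm_num) (by push_cast; linarith) (by push_cast; linarith)

theorem crossings_of_lt (hf : SelfSimilarCurve f) {z c s t : ℝ} (hc : 0 < c) (hst : s ≤ t)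
    (hz : z < c / 2) : crossings f z c s t = 0 :=
  crossings_eq_zero hf.uc hc hst (Or.inl fun u _ _ => by linarith [(hf.mem u).1])

theorem crossings_of_gt (hf : SelfSimilarCurve f) {z c s t : ℝ} (hc : 0 < c) (hst : s ≤ t)
    (hz : 1 - c / 2 < z) : crossings f z c s t = 0 :=
  crossings_eq_zero hf.uc hc hst (Or.inr fun u _ _ => by linarith [(hf.mem u).2])

theorem crossings_of_notMem (hf : SelfSimilarCurve f) {z c s t : ℝ} (hc : 0 < c) (hst : s ≤ t)
    (hz : z ∉ Set.Icc (0 : ℝ) 1) : crossings f z c s t = 0 := by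
  rcases lt_or_ge z 0 with h | h
  · exact hf.crossings_of_lt hc hst (by linarith)
  · have h1 : 1 < z := by
      by_contra! h1
      exact hz ⟨h, h1⟩
    exact hf.crossings_of_gt hc hst (by linarith)

theorem crossings_self (hf : SelfSimilarCurve f) {z c s : ℝ} (hc : 0 < c) :
    crossings f z c s s = 0 := by
  refine crossings_eq_zero hf.uc hc le_rfl ?_
  by_cases h : f s < z + c / 2
  · exact Or.inr fun u h1 h2 => by rwa [le_antisymm h2 h1]
  · exact Or.inl fun u h1 h2 => by rw [le_antisymm h2 h1]; linarith

theorem crossings_cell (hf : SelfSimilarCurve f) {l : ℕ} (hl : l < 9) {t : ℝ}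
    (ht : t ∈ Set.Icc (0 : ℝ) 1) (z c : ℝ) :
    crossings f (cellMap l z) c (l / 9) ((l + t) / 9) = crossings f z (3 * c) 0 t := by
  let e : ℝ ≃o ℝ := (OrderIso.addLeft (l : ℝ)).trans
    (OrderIso.divRight₀ (9 : ℝ) (by norm_num))
  have he : ∀ u, e u = (l + u) / 9 := fun u => rfl
  have h0 : (l : ℝ) / 9 = e 0 := by rw [he, add_zero]
  rw [h0, ← he]
  simp only [crossings, ups, downs, passCount_map]
  have hcell : ∀ u, 0 ≤ u → u ≤ t → f (e u) = cellMap l (f u) := fun u h1 h2 => by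
    rw [he, hf.cell l hl u ⟨h1, h2.trans ht.2⟩]
  by_cases h1 : l % 3 = 1
  · rw [add_comm]
    simp only [cellMap, h1, if_true] at hcell ⊢
    congr 1 <;> refine passCount_congr (fun u h2 h3 => ?_) (fun u h2 h3 => ?_) <;>
      rw [hcell u h2 h3] <;> constructor <;> intro h4 <;> linarith
  · simp only [cellMap, h1, if_false] at hcell ⊢
    congr 1 <;> refine passCount_congr (fun u h2 h3 => ?_) (fun u h2 h3 => ?_) <;>
      rw [hcell u h2 h3] <;> constructor <;> intro h4 <;> linarith

theorem crossings_of_large (hf : SelfSimilarCurve f) {z c : ℝ} (hc : 1 / 3 < c) (h0 : c / 2 < z)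
    (h1 : z < 1 - c / 2) : crossings f z c 0 1 = 1 := by
  refine crossings_eq_one hf.uc (by linarith) zero_le_one (by rw [hf.apply_zero]; linarith)
    (by rw [hf.apply_one]; linarith) fun u v hu huv hv h => ?_
  linarith [hf.le_add_third hu huv hv]

theorem apply_ninth_mem (hf : SelfSimilarCurve f) {l : ℕ} (hl : l ≤ 9) :
    ∃ j : ℕ, j ≤ 3 ∧ f ((l : ℝ) / 9) = (j : ℝ) / 3 := by
  rcases Nat.lt_or_eq_of_le hl with h | rfl
  · have := hf.cell l h 0 (by simp)
    rw [add_zero, hf.apply_zero, cellMap] at this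
    rw [this]
    split_ifs
    · exact ⟨l / 3 + 1, by omega, by push_cast; ring⟩
    · exact ⟨l / 3, by omega, by ring⟩
  · exact ⟨3, le_rfl, by norm_num [hf.apply_one]⟩

theorem crossings_eq_sum (hf : SelfSimilarCurve f) {z c : ℝ} (hc : 0 < c)
    (hz : ∀ j : ℕ, j ≤ 3 → c / 2 < |(j : ℝ) / 3 - z|) {i : ℕ} (hi : i ≤ 9) :
    crossings f z c 0 (i / 9) = ∑ l ∈ Finset.range i, crossings f z c (l / 9) ((l + 1) / 9) := by
  induction i with
  | zero => simp [hf.crossings_self hc]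
  | succ i ih =>
    obtain ⟨j, hj, hij⟩ := hf.apply_ninth_mem (l := i) (by omega)
    rw [Finset.sum_range_succ, ← ih (by omega), Nat.cast_succ,
      crossings_eq_add hf.uc hc (r := (i : ℝ) / 9) (by positivity) (by gcongr; linarith)
      (by rw [hij]; exact hz j hj)]

theorem crossings_near_grid (hf : SelfSimilarCurve f) {z c : ℝ} (hc : 0 < c) (hc3 : c ≤ 1 / 3)
    {j : ℕ} (hj : j = 1 ∨ j = 2) (hz : |(j : ℝ) / 3 - z| < c / 2) :
    crossings f z c 0 1 = 1 ∧ ∀ l : ℕ, l < 9 → crossings f z c (l / 9) ((l + 1) / 9) = 0 := by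
  rw [abs_lt] at hz
  have hj1 : (1 : ℝ) ≤ j := by exact_mod_cast (by omega : 1 ≤ j)
  have hj2 : (j : ℝ) ≤ 2 := by exact_mod_cast (by omega : j ≤ 2)
  constructor
  · refine crossings_eq_one hf.uc hc zero_le_one (by rw [hf.apply_zero]; linarith)
      (by rw [hf.apply_one]; linarith) fun u v hu huv hv h => ?_
    have h1 : (j : ℝ) / 3 ≤ u := by
      by_contra! hlt
      linarith [hf.le_grid (by omega) hu hlt.le]
    linarith [hf.grid_le (by omega) (h1.trans huv) hv]
  · intro l hl
    refine crossings_eq_zero hf.uc hc (by gcongr; linarith) ?_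
    rcases Nat.lt_or_ge (l / 3) j with h | h
    · right
      intro u hu hu'
      have h1 : ((l / 3 : ℕ) : ℝ) + 1 ≤ j := by exact_mod_cast h
      linarith [(hf.cell_mem hl hu hu').2]
    · left
      intro u hu hu'
      have h1 : (j : ℝ) ≤ ((l / 3 : ℕ) : ℝ) := by exact_mod_cast h
      linarith [(hf.cell_mem hl hu hu').1]

theorem crossings_recursion (hf : SelfSimilarCurve f) {z c : ℝ} (hc : 0 < c) (hc3 : c ≤ 1 / 3)
    (hz : ∀ j : ℕ, j ≤ 3 → |(j : ℝ) / 3 - z| ≠ c / 2) :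
    (crossings f z c 0 1 : ℝ) =
      (∑ l ∈ Finset.range 9, (crossings f z c (l / 9) ((l + 1) / 9) : ℝ)) +
      ((Set.Ioo (1 / 3 - c / 2) (1 / 3 + c / 2)).indicator 1 z +
        (Set.Ioo (2 / 3 - c / 2) (2 / 3 + c / 2)).indicator 1 z) := by
  have hmem : ∀ p : ℝ, z ∈ Set.Ioo (p - c / 2) (p + c / 2) ↔ |p - z| < c / 2 := by
    intro p
    rw [abs_lt]
    constructor <;> rintro ⟨h1, h2⟩ <;> constructor <;> linarith
  simp only [Set.indicator_apply, hmem, Pi.one_apply]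
  by_cases h1 : |1 / 3 - z| < c / 2
  · have h2 : ¬ |2 / 3 - z| < c / 2 := by
      rw [abs_lt] at h1 ⊢
      rintro ⟨h3, h4⟩
      linarith [h1.1]
    obtain ⟨h3, h4⟩ := hf.crossings_near_grid hc hc3 (j := 1) (by simp) (by simpa using h1)
    rw [h3, if_pos h1, if_neg h2, Finset.sum_eq_zero]
    · simp
    · intro l hl
      rw [h4 l (Finset.mem_range.1 hl), Nat.cast_zero]
  by_cases h2 : |2 / 3 - z| < c / 2
  · obtain ⟨h3, h4⟩ := hf.crossings_near_grid hc hc3 (j := 2) (by simp) (by simpa using h2)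
    rw [h3, if_neg h1, if_pos h2, Finset.sum_eq_zero]
    · simp
    · intro l hl
      rw [h4 l (Finset.mem_range.1 hl), Nat.cast_zero]
  rw [if_neg h1, if_neg h2, add_zero, add_zero]
  have hle : ∀ l : ℕ, (l : ℝ) / 9 ≤ (l + 1) / 9 := fun l => by gcongr; linarith
  by_cases h0 : z < c / 2
  · rw [hf.crossings_of_lt hc zero_le_one h0, Finset.sum_eq_zero]
    · simp
    · intro l _
      rw [hf.crossings_of_lt hc (hle l) h0, Nat.cast_zero]
  by_cases h3 : 1 - c / 2 < z
  · rw [hf.crossings_of_gt hc zero_le_one h3, Finset.sum_eq_zero]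
    · simp
    · intro l _
      rw [hf.crossings_of_gt hc (hle l) h3, Nat.cast_zero]
  have h := hf.crossings_eq_sum hc (z := z) (i := 9) (fun j hj => by
    refine lt_of_le_of_ne ?_ (hz j hj).symm
    interval_cases j
    · rw [le_abs]
      right
      push_cast
      linarith
    · simpa using h1
    · simpa using h2
    · rw [le_abs]
      left
      push_cast
      linarith) le_rfl
  have h9 : ((9 : ℕ) : ℝ) / 9 = 1 := by norm_num
  rw [h9] at h
  rw [h, Nat.cast_sum]

theorem abs_crossings_sub_le (hf : SelfSimilarCurve f) {c : ℝ} (hc : 0 < c) (z : ℝ) {i : ℕ}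
    (hi : i < 9) {t : ℝ} (ht : 0 ≤ t) :
    |(crossings f z c 0 ((i + t) / 9) : ℝ) -
      ((∑ l ∈ Finset.range i, (crossings f z c (l / 9) ((l + 1) / 9) : ℝ)) +
        crossings f z c (i / 9) ((i + t) / 9))| ≤ 18 := by
  have key : ∀ i : ℕ,
      (∑ l ∈ Finset.range i, crossings f z c (l / 9) ((l + 1) / 9)) ≤ crossings f z c 0 (i / 9) ∧
      crossings f z c 0 (i / 9) ≤
        (∑ l ∈ Finset.range i, crossings f z c (l / 9) ((l + 1) / 9)) + 2 * i := by
    intro i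
    induction i with
    | zero => simp [hf.crossings_self hc]
    | succ i ih =>
      rw [Finset.sum_range_succ, Nat.cast_succ]
      have h0 : (0 : ℝ) ≤ i / 9 := by positivity
      have h1 : (i : ℝ) / 9 ≤ (i + 1) / 9 := by gcongr; linarith
      have h2 := crossings_add_le hf.uc hc z h0 h1
      have h3 := crossings_le_add hf.uc hc z h0 h1
      omega
  have h0 : (0 : ℝ) ≤ i / 9 := by positivity
  have h1 : (i : ℝ) / 9 ≤ (i + t) / 9 := by gcongr; linarith
  have h2 := crossings_add_le hf.uc hc z h0 h1
  have h3 := crossings_le_add hf.uc hc z h0 h1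
  have h4 := key i
  rw [← Nat.cast_sum, ← Nat.cast_add, abs_le]
  generalize (∑ l ∈ Finset.range i, crossings f z c (l / 9) ((l + 1) / 9)) = S at *
  have h5 : S + crossings f z c (i / 9) ((i + t) / 9) ≤ crossings f z c 0 ((i + t) / 9) := by omega
  have h6 : crossings f z c 0 ((i + t) / 9) ≤
    S + crossings f z c (i / 9) ((i + t) / 9) + 18 := by omega
  have h5' : ((S + crossings f z c (i / 9) ((i + t) / 9) : ℕ) : ℝ) ≤
    crossings f z c 0 ((i + t) / 9) := by exact_mod_cast h5
  have h6' : (crossings f z c 0 ((i + t) / 9) : ℝ) ≤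
    ((S + crossings f z c (i / 9) ((i + t) / 9) : ℕ) : ℝ) + 18 := by exact_mod_cast h6
  constructor <;> linarith

end SelfSimilarCurve

/-- The space integral of `g` weighted by the numbers of crossings during `[s, t]`. -/
def crossInt (f : ℝ → ℝ) (c s t : ℝ) (g : ℝ → ℝ) : ℝ := ∫ z, (crossings f z c s t : ℝ) * g z

namespace SelfSimilarCurve

variable {f : ℝ → ℝ}

open MeasureTheory

theorem integrable_crossings (hf : SelfSimilarCurve f) {c s t : ℝ} (hc : 0 < c) (hst : s ≤ t)
    {g : ℝ → ℝ} (hg : Continuous g) : Integrable fun z => (crossings f z c s t : ℝ) * g z := by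
  obtain ⟨B, hB⟩ := hf.uc.exists_crossings_le hc hst
  have hon : IntegrableOn (fun z => (crossings f z c s t : ℝ) * g z) (Set.Icc 0 1) := by
    refine Integrable.bdd_mul (c := B) (hg.continuousOn.integrableOn_Icc)
      (measurable_crossings hf.uc hc hst).aestronglyMeasurable (Eventually.of_forall fun z => ?_)
    rw [Real.norm_of_nonneg (Nat.cast_nonneg _)]
    exact hB z
  refine (integrableOn_iff_integrable_of_support_subset fun z hz => ?_).1 hon
  by_contra hz'
  exact hz (by simp [hf.crossings_of_notMem hc hst hz'])

theorem crossInt_cell (hf : SelfSimilarCurve f) {l : ℕ} (hl : l < 9) {t : ℝ}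
    (ht : t ∈ Set.Icc (0 : ℝ) 1) (c : ℝ) (g : ℝ → ℝ) :
    crossInt f c (l / 9) ((l + t) / 9) g =
      1 / 3 * crossInt f (3 * c) 0 t (fun z => g (cellMap l z)) := by
  have := integral_comp_cellMap l fun z => (crossings f z c (l / 9) ((l + t) / 9) : ℝ) * g z
  simp only [hf.crossings_cell hl ht] at this
  rw [crossInt, crossInt, this]
  ring

theorem crossInt_one_of_large (hf : SelfSimilarCurve f) {c : ℝ} (hc : 1 / 3 < c) (hc1 : c ≤ 1) :
    crossInt f c 0 1 (fun _ => 1) = 1 - c := by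
  have hc0 : 0 < c := by linarith
  have hae : (fun z => (crossings f z c 0 1 : ℝ) * 1) =ᵐ[volume]
      (Set.Ioo (c / 2) (1 - c / 2)).indicator 1 := by
    have hcount : ({c / 2, 1 - c / 2} : Set ℝ).Countable := (Set.toFinite _).countable
    filter_upwards [hcount.ae_notMem volume] with z hz
    simp only [Set.mem_insert_iff, Set.mem_singleton_iff, not_or] at hz
    rw [mul_one, Set.indicator_apply]
    split_ifs with h
    · rw [hf.crossings_of_large hc h.1 h.2]
      simp
    · rcases lt_or_gt_of_ne hz.1 with h1 | h1
      · rw [hf.crossings_of_lt hc0 zero_le_one h1, Nat.cast_zero]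
      · have h2 : 1 - c / 2 < z := lt_of_le_of_ne (not_lt.1 fun h2 => h ⟨h1, h2⟩) (Ne.symm hz.2)
        rw [hf.crossings_of_gt hc0 zero_le_one h2, Nat.cast_zero]
  rw [crossInt, integral_congr_ae hae, integral_indicator_one measurableSet_Ioo,
    Real.volume_real_Ioo_of_le (by linarith)]
  ring

theorem crossInt_one_recursion (hf : SelfSimilarCurve f) {c : ℝ} (hc : 0 < c) (hc3 : c ≤ 1 / 3) :
    crossInt f c 0 1 (fun _ => 1) = 3 * crossInt f (3 * c) 0 1 (fun _ => 1) + 2 * c := by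
  have hae : (fun z => (crossings f z c 0 1 : ℝ) * 1) =ᵐ[volume] fun z =>
      (∑ l ∈ Finset.range 9, (crossings f z c (l / 9) ((l + 1) / 9) : ℝ) * 1) +
      ((Set.Ioo (1 / 3 - c / 2) (1 / 3 + c / 2)).indicator 1 z +
        (Set.Ioo (2 / 3 - c / 2) (2 / 3 + c / 2)).indicator 1 z) := by
    have hcount : (⋃ j : ℕ, ({(j : ℝ) / 3 - c / 2, (j : ℝ) / 3 + c / 2} : Set ℝ)).Countable :=
      Set.countable_iUnion fun j => (Set.toFinite _).countable
    filter_upwards [hcount.ae_notMem volume] with z hz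
    simp only [mul_one]
    refine hf.crossings_recursion hc hc3 fun j _ hj => hz (Set.mem_iUnion.2 ⟨j, ?_⟩)
    simp only [Set.mem_insert_iff, Set.mem_singleton_iff]
    rcases (abs_eq (by positivity)).1 hj with h | h
    · left; linarith
    · right; linarith
  have hle : ∀ l : ℕ, (l : ℝ) / 9 ≤ (l + 1) / 9 := fun l => by gcongr; linarith
  have hind : ∀ p : ℝ, Integrable ((Set.Ioo (p - c / 2) (p + c / 2)).indicator (1 : ℝ → ℝ)) :=
    fun p => (integrable_indicator_iff measurableSet_Ioo).2
      (integrableOn_const (by simp) (by simp) : IntegrableOn (fun _ => (1 : ℝ)) _ _)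
  have hindc : ∀ p : ℝ, ∫ z, (Set.Ioo (p - c / 2) (p + c / 2)).indicator (1 : ℝ → ℝ) z = c :=
    fun p => by
      rw [integral_indicator_one measurableSet_Ioo, Real.volume_real_Ioo_of_le (by linarith)]
      ring
  have hint : ∀ l ∈ Finset.range 9,
      Integrable fun z => (crossings f z c (l / 9) ((l + 1) / 9) : ℝ) * 1 :=
    fun l _ => hf.integrable_crossings hc (hle l) continuous_const
  have hcell : ∀ l ∈ Finset.range 9, ∫ z, (crossings f z c (l / 9) ((l + 1) / 9) : ℝ) * 1 =
      1 / 3 * crossInt f (3 * c) 0 1 (fun _ => 1) :=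
    fun l hl => hf.crossInt_cell (Finset.mem_range.1 hl) (by simp) c fun _ => 1
  have hadd : Integrable fun z =>
      (Set.Ioo (1 / 3 - c / 2) (1 / 3 + c / 2)).indicator (1 : ℝ → ℝ) z +
      (Set.Ioo (2 / 3 - c / 2) (2 / 3 + c / 2)).indicator 1 z := (hind (1 / 3)).add (hind (2 / 3))
  rw [crossInt, integral_congr_ae hae, integral_add (integrable_finsetSum _ hint) hadd,
    integral_finsetSum _ hint, Finset.sum_congr rfl hcell,
    integral_add (hind (1 / 3)) (hind (2 / 3)), hindc, hindc, Finset.sum_const,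
    Finset.card_range]
  simp only [nsmul_eq_mul]
  push_cast
  ring

theorem crossInt_one_eq (hf : SelfSimilarCurve f) {c : ℝ} (hc : 0 < c) (hc1 : c ≤ 1) :
    crossInt f c 0 1 (fun _ => 1) = (phiFn c)⁻¹ - c / 4 := by
  have key : ∀ n : ℕ, ∀ c : ℝ, (1 / 3) ^ (n + 1) < c → c ≤ 1 →
      crossInt f c 0 1 (fun _ => 1) = (phiFn c)⁻¹ - c / 4 := by
    intro n
    induction n with
    | zero =>
      intro c hc hc1
      rw [zero_add, pow_one] at hc
      rw [hf.crossInt_one_of_large hc hc1, inv_phiFn_of_mem ⟨hc, hc1⟩]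
      ring
    | succ n ih =>
      intro c hc hc1
      by_cases h : 1 / 3 < c
      · rw [hf.crossInt_one_of_large h hc1, inv_phiFn_of_mem ⟨h, hc1⟩]
        ring
      · have hc0 : 0 < c := lt_trans (by positivity) hc
        rw [pow_succ] at hc
        rw [hf.crossInt_one_recursion hc0 (not_lt.1 h), ih (3 * c) (by linarith) (by linarith),
          phiFn_scale hc0, mul_inv]
        ring
  obtain ⟨n, hn⟩ := exists_pow_lt_of_lt_one hc (show (1 / 3 : ℝ) < 1 by norm_num)
  refine key n c (lt_of_le_of_lt ?_ hn) hc1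
  exact pow_le_pow_of_le_one (by norm_num) (by norm_num) (Nat.le_succ n)

theorem tendsto_crossInt_one (hf : SelfSimilarCurve f) :
    Tendsto (fun c => phiFn c * crossInt f c 0 1 (fun _ => 1)) (nhdsWithin 0 (Set.Ioi 0))
      (nhds 1) := by
  have hid : Tendsto (fun c : ℝ => c) (nhdsWithin 0 (Set.Ioi 0)) (nhds 0) :=
    tendsto_id.mono_left nhdsWithin_le_nhds
  have h : Tendsto (fun c : ℝ => 1 - phiFn c * c / 4) (nhdsWithin 0 (Set.Ioi 0)) (nhds 1) := by
    have := ((tendsto_phiFn.mul hid).div_const 4).const_sub 1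
    simpa using this
  refine h.congr' ?_
  filter_upwards [Ioo_mem_nhdsGT (show (0 : ℝ) < 1 by norm_num)] with c hc
  rw [hf.crossInt_one_eq hc.1 hc.2.le, mul_sub, mul_inv_cancel₀ (phiFn_pos hc.1).ne']
  ring

theorem abs_crossInt_sub_le (hf : SelfSimilarCurve f) {c : ℝ} (hc : 0 < c) {i : ℕ} (hi : i < 9)
    {t : ℝ} (ht : t ∈ Set.Icc (0 : ℝ) 1) {g : ℝ → ℝ} (hg : Continuous g) {K : ℝ}
    (hK : ∀ z ∈ Set.Icc (0 : ℝ) 1, |g z| ≤ K) :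
    |crossInt f c 0 ((i + t) / 9) g -
      ((∑ l ∈ Finset.range i, 1 / 3 * crossInt f (3 * c) 0 1 (fun z => g (cellMap l z))) +
        1 / 3 * crossInt f (3 * c) 0 t (fun z => g (cellMap i z)))| ≤ 18 * K := by
  have ht0 := ht.1
  have hle : ∀ l : ℕ, (l : ℝ) / 9 ≤ (l + 1) / 9 := fun l => by gcongr; linarith
  have hlt : (i : ℝ) / 9 ≤ (i + t) / 9 := by gcongr; linarith
  have h0t : (0 : ℝ) ≤ (i + t) / 9 := by positivity
  have hint : ∀ l ∈ Finset.range i,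
      Integrable fun z => (crossings f z c (l / 9) ((l + 1) / 9) : ℝ) * g z :=
    fun l _ => hf.integrable_crossings hc (hle l) hg
  have hS : (∑ l ∈ Finset.range i, 1 / 3 * crossInt f (3 * c) 0 1 (fun z => g (cellMap l z))) =
      ∑ l ∈ Finset.range i, ∫ z, (crossings f z c (l / 9) ((l + 1) / 9) : ℝ) * g z := by
    refine Finset.sum_congr rfl fun l hl => ?_
    rw [← hf.crossInt_cell ((Finset.mem_range.1 hl).trans hi) (by simp) c g, crossInt]
  have hadd : Integrable fun z =>
      (∑ l ∈ Finset.range i, (crossings f z c (l / 9) ((l + 1) / 9) : ℝ) * g z) +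
        (crossings f z c (i / 9) ((i + t) / 9) : ℝ) * g z :=
    (integrable_finsetSum _ hint).add (hf.integrable_crossings hc hlt hg)
  rw [hS, ← hf.crossInt_cell hi ht c g, ← integral_finsetSum _ hint, crossInt, crossInt,
    ← integral_add (integrable_finsetSum _ hint) (hf.integrable_crossings hc hlt hg),
    ← integral_sub (hf.integrable_crossings hc h0t hg) hadd,
    ← setIntegral_eq_integral_of_forall_compl_eq_zero (s := Set.Icc 0 1)]
  · have := norm_setIntegral_le_of_norm_le_const (μ := volume) (s := Set.Icc (0 : ℝ) 1)
      (C := 18 * K) (f := fun z => (crossings f z c 0 ((i + t) / 9) : ℝ) * g z -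
        ((∑ l ∈ Finset.range i, (crossings f z c (l / 9) ((l + 1) / 9) : ℝ) * g z) +
          (crossings f z c (i / 9) ((i + t) / 9) : ℝ) * g z)) (by simp) (fun z hz => ?_)
    · simpa using this
    · rw [← Finset.sum_mul, ← add_mul, ← sub_mul, norm_mul]
      exact mul_le_mul (hf.abs_crossings_sub_le hc z hi ht0) (hK z hz) (norm_nonneg _)
        (by norm_num)
  · intro z hz
    rw [hf.crossings_of_notMem hc h0t hz, hf.crossings_of_notMem hc hlt hz, Finset.sum_eq_zero]
    · simp
    · intro l _
      rw [hf.crossings_of_notMem hc (hle l) hz, Nat.cast_zero, zero_mul]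

theorem abs_crossInt_le (hf : SelfSimilarCurve f) {c : ℝ} (hc : 0 < c) {t : ℝ}
    (ht : t ∈ Set.Icc (0 : ℝ) 1) {g : ℝ → ℝ} {K : ℝ} (hK : ∀ z ∈ Set.Icc (0 : ℝ) 1, |g z| ≤ K) :
    |crossInt f c 0 t g| ≤ K * crossInt f c 0 1 (fun _ => 1) := by
  rw [crossInt, crossInt, ← integral_const_mul, ← Real.norm_eq_abs]
  refine norm_integral_le_of_norm_le ((hf.integrable_crossings hc zero_le_one
    continuous_const).const_mul K) (Eventually.of_forall fun z => ?_)
  rw [norm_mul, Real.norm_of_nonneg (Nat.cast_nonneg _), mul_one, mul_comm]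
  by_cases hz : z ∈ Set.Icc (0 : ℝ) 1
  · refine mul_le_mul (hK z hz) ?_ (Nat.cast_nonneg _) ((abs_nonneg _).trans (hK z hz))
    have := crossings_add_le hf.uc hc z ht.1 ht.2
    exact_mod_cast (Nat.le_add_right _ _).trans this
  · rw [hf.crossings_of_notMem hc ht.1 hz, hf.crossings_of_notMem hc zero_le_one hz]
    simp

theorem integral_cell (hf : SelfSimilarCurve f) {l : ℕ} (hl : l < 9) {t : ℝ}
    (ht : t ∈ Set.Icc (0 : ℝ) 1) (g : ℝ → ℝ) :
    ∫ s in ((l : ℝ) / 9)..((l + t) / 9), g (f s) =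
      1 / 9 * ∫ s in (0 : ℝ)..t, g (cellMap l (f s)) := by
  have h := intervalIntegral.integral_comp_add_mul (a := 0) (b := t) (fun s => g (f s))
    (show (1 / 9 : ℝ) ≠ 0 by norm_num) (l / 9)
  rw [show (l : ℝ) / 9 + 1 / 9 * 0 = l / 9 by ring,
    show (l : ℝ) / 9 + 1 / 9 * t = (l + t) / 9 by ring, smul_eq_mul] at h
  have h2 : ∫ s in (0 : ℝ)..t, g (f (l / 9 + 1 / 9 * s)) =
      ∫ s in (0 : ℝ)..t, g (cellMap l (f s)) := by
    refine intervalIntegral.integral_congr fun s hs => ?_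
    rw [Set.uIcc_of_le ht.1] at hs
    rw [← hf.cell l hl s ⟨hs.1, hs.2.trans ht.2⟩]
    congr 2
    ring
  rw [← h2, h]
  ring

theorem integral_split (hf : SelfSimilarCurve f) {i : ℕ} (hi : i < 9) {t : ℝ}
    (ht : t ∈ Set.Icc (0 : ℝ) 1) {g : ℝ → ℝ} (hg : Continuous g) :
    ∫ s in (0 : ℝ)..((i + t) / 9), g (f s) =
      (∑ l ∈ Finset.range i, 1 / 9 * ∫ s in (0 : ℝ)..1, g (cellMap l (f s))) +
        1 / 9 * ∫ s in (0 : ℝ)..t, g (cellMap i (f s)) := by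
  have hii : ∀ a b, IntervalIntegrable (fun s => g (f s)) volume a b :=
    fun a b => (hg.comp hf.uc.continuous).intervalIntegrable a b
  rw [← intervalIntegral.integral_add_adjacent_intervals (hii 0 (i / 9)) (hii (i / 9) _),
    hf.integral_cell hi ht]
  congr 1
  have h := intervalIntegral.sum_integral_adjacent_intervals (f := fun s => g (f s))
    (μ := volume) (a := fun l : ℕ => (l : ℝ) / 9) (n := i) fun l _ => hii _ _
  simp only [Nat.cast_zero, zero_div] at h
  rw [← h]
  refine Finset.sum_congr rfl fun l hl => ?_
  rw [← hf.integral_cell ((Finset.mem_range.1 hl).trans hi) (by simp), Nat.cast_succ]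

end SelfSimilarCurve

/-- The oscillation of `g` on `[0, 1]` at scale `3 ^ (-M)` is at most `ε`. -/
def OscLE (g : ℝ → ℝ) (M : ℕ) (ε : ℝ) : Prop :=
  ∀ y ∈ Set.Icc (0 : ℝ) 1, ∀ z ∈ Set.Icc (0 : ℝ) 1, |y - z| ≤ (1 / 3) ^ M → |g y - g z| ≤ ε

theorem OscLE.comp_cellMap {g : ℝ → ℝ} {M : ℕ} {ε : ℝ} (h : OscLE g (M + 1) ε) {l : ℕ}
    (hl : l < 9) : OscLE (fun z => g (cellMap l z)) M ε := by
  intro y hy z hz hyz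
  refine h _ (cellMap_mem_unit hl hy) _ (cellMap_mem_unit hl hz) ?_
  rw [abs_cellMap_sub, pow_succ]
  linarith

theorem OscLE.abs_sub_zero_le {g : ℝ → ℝ} {ε : ℝ} (h : OscLE g 0 ε) {z : ℝ}
    (hz : z ∈ Set.Icc (0 : ℝ) 1) : |g z - g 0| ≤ ε := by
  refine h z hz 0 (by simp) ?_
  rw [pow_zero, sub_zero, abs_of_nonneg hz.1]
  exact hz.2

theorem Continuous.exists_oscLE {g : ℝ → ℝ} (hg : Continuous g) {ε : ℝ} (hε : 0 < ε) :
    ∃ M₀ : ℕ, ∀ M ≥ M₀, OscLE g M ε := by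
  have hu := isCompact_Icc.uniformContinuousOn_of_continuous
    (hg.continuousOn (s := Set.Icc (0 : ℝ) 1))
  obtain ⟨δ, hδ, h⟩ := Metric.uniformContinuousOn_iff.1 hu ε hε
  obtain ⟨n, hn⟩ := exists_pow_lt_of_lt_one hδ (show (1 / 3 : ℝ) < 1 by norm_num)
  refine ⟨n, fun M hM y hy z hz hyz => (h y hy z hz ?_).le⟩
  exact (hyz.trans (pow_le_pow_of_le_one (by norm_num) (by norm_num) hM)).trans_lt hn

/-- The normalized crossing integral of `g` during `[0, t]` asymptotically approximates the
occupation integral of `g` up to an error `e`. -/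
def CrossErrorLE (f : ℝ → ℝ) (t : ℝ) (g : ℝ → ℝ) (e : ℝ) : Prop :=
  ∀ b > e, ∀ᶠ c in nhdsWithin (0 : ℝ) (Set.Ioi 0),
    |phiFn c * crossInt f c 0 t g - ∫ s in (0 : ℝ)..t, g (f s)| < b

namespace SelfSimilarCurve

variable {f : ℝ → ℝ}

open MeasureTheory

theorem crossErrorLE_cell (hf : SelfSimilarCurve f) {i : ℕ} (hi : i < 9) {t : ℝ}
    (ht : t ∈ Set.Icc (0 : ℝ) 1) {g : ℝ → ℝ} (hg : Continuous g) {e₁ e₂ : ℝ}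
    (h₁ : ∀ l < 9, CrossErrorLE f 1 (fun z => g (cellMap l z)) e₁)
    (h₂ : CrossErrorLE f t (fun z => g (cellMap i z)) e₂) :
    CrossErrorLE f ((i + t) / 9) g (i / 9 * e₁ + 1 / 9 * e₂) := by
  intro b hb
  obtain ⟨K, hK⟩ := isCompact_Icc.exists_bound_of_continuousOn
    (hg.continuousOn (s := Set.Icc (0 : ℝ) 1))
  obtain ⟨η, hη⟩ : ∃ η, η = b - (i / 9 * e₁ + 1 / 9 * e₂) := ⟨_, rfl⟩
  have hη0 : 0 < η := by rw [hη]; linarith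
  have hscale : Tendsto (fun c : ℝ => 3 * c) (nhdsWithin 0 (Set.Ioi 0))
      (nhdsWithin 0 (Set.Ioi 0)) := by
    refine tendsto_nhdsWithin_of_tendsto_nhds_of_eventually_within _ ?_ ?_
    · have : Tendsto (fun c : ℝ => 3 * c) (nhds 0) (nhds (3 * 0)) :=
        (continuous_const_mul 3).tendsto 0
      rw [mul_zero] at this
      exact this.mono_left nhdsWithin_le_nhds
    · filter_upwards [self_mem_nhdsWithin] with c hc
      exact mul_pos three_pos (Set.mem_Ioi.1 hc)
  have hsmall : ∀ᶠ c in nhdsWithin (0 : ℝ) (Set.Ioi 0), phiFn c * (18 * K) < η / 2 := by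
    have := tendsto_phiFn.mul_const (18 * K)
    rw [zero_mul] at this
    exact this.eventually_lt_const (by linarith)
  have hall : ∀ᶠ c in nhdsWithin (0 : ℝ) (Set.Ioi 0), ∀ l ∈ Finset.range i,
      |phiFn (3 * c) * crossInt f (3 * c) 0 1 (fun z => g (cellMap l z)) -
        ∫ s in (0 : ℝ)..1, g (cellMap l (f s))| < e₁ + η / 2 :=
    (Finset.range i).eventually_all.2 fun l hl =>
      hscale.eventually (h₁ l ((Finset.mem_range.1 hl).trans hi) _ (by linarith))
  filter_upwards [hsmall, hall, hscale.eventually (h₂ (e₂ + η / 2) (by linarith)),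
    self_mem_nhdsWithin] with c hc1 hc2 hc3 hc0
  have hc0 : 0 < c := hc0
  have hX := hf.abs_crossInt_sub_le hc0 hi ht hg hK
  rw [hf.integral_split hi ht hg]
  have hφ := phiFn_pos hc0
  rw [phiFn_scale hc0] at hc2 hc3
  set S := (∑ l ∈ Finset.range i, 1 / 3 * crossInt f (3 * c) 0 1 (fun z => g (cellMap l z))) with hS
  set I := (∑ l ∈ Finset.range i, 1 / 9 * ∫ s in (0 : ℝ)..1, g (cellMap l (f s))) with hI
  have hSI : |phiFn c * S - I| ≤ i / 9 * (e₁ + η / 2) := by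
    rw [hS, hI, Finset.mul_sum, ← Finset.sum_sub_distrib]
    refine (Finset.abs_sum_le_sum_abs _ _).trans ((Finset.sum_le_card_nsmul _ _
      (1 / 9 * (e₁ + η / 2)) fun l hl => ?_).trans_eq ?_)
    · rw [show ∀ a b : ℝ, phiFn c * (1 / 3 * a) - 1 / 9 * b = 1 / 9 * (3 * phiFn c * a - b) by
        intros; ring, abs_mul, abs_of_pos (by norm_num)]
      exact mul_le_mul_of_nonneg_left (hc2 l hl).le (by norm_num)
    · rw [Finset.card_range, nsmul_eq_mul]
      ring
  have hX' : |phiFn c * (crossInt f c 0 ((i + t) / 9) g -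
      (S + 1 / 3 * crossInt f (3 * c) 0 t (fun z => g (cellMap i z))))| < η / 2 := by
    rw [abs_mul, abs_of_pos hφ]
    exact (mul_le_mul_of_nonneg_left hX hφ.le).trans_lt hc1
  have hi8 : (i : ℝ) ≤ 8 := by exact_mod_cast Nat.lt_succ_iff.1 hi
  rw [abs_lt] at hX' hc3 ⊢
  rw [abs_le] at hSI
  constructor <;> nlinarith

theorem crossErrorLE_one (hf : SelfSimilarCurve f) (M : ℕ) {ε : ℝ} :
    ∀ {g : ℝ → ℝ}, Continuous g → OscLE g M ε → CrossErrorLE f 1 g (2 * ε) := by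
  induction M with
  | zero =>
    intro g hg hM b hb
    have hgf : IntervalIntegrable (fun s => g (f s)) volume 0 1 :=
      (hg.comp hf.uc.continuous).intervalIntegrable _ _
    have hint : |(∫ s in (0 : ℝ)..1, g (f s)) - g 0| ≤ ε := by
      have h := intervalIntegral.norm_integral_le_of_norm_le_const (a := 0) (b := 1) (C := ε)
        (f := fun s => g (f s) - g 0) fun s _ => hM.abs_sub_zero_le (hf.mem s)
      rw [intervalIntegral.integral_sub hgf intervalIntegrable_const] at h
      simpa using h
    have hlim : Tendsto (fun c => ε * (phiFn c * crossInt f c 0 1 (fun _ => 1)) +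
        |g 0| * |phiFn c * crossInt f c 0 1 (fun _ => 1) - 1| + ε) (nhdsWithin 0 (Set.Ioi 0))
        (nhds (2 * ε)) := by
      have h := hf.tendsto_crossInt_one
      have := ((h.const_mul ε).add (((h.sub_const 1).abs).const_mul |g 0|)).add_const ε
      simpa [two_mul] using this
    filter_upwards [hlim.eventually_lt_const hb, self_mem_nhdsWithin] with c hc hc0
    have hc0 : 0 < c := hc0
    refine lt_of_le_of_lt ?_ hc
    have hsub : crossInt f c 0 1 (fun z => g z - g 0) =
        crossInt f c 0 1 g - g 0 * crossInt f c 0 1 (fun _ => 1) := by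
      rw [crossInt, crossInt, crossInt, ← integral_const_mul, ← integral_sub
        (hf.integrable_crossings hc0 zero_le_one hg)
        ((hf.integrable_crossings hc0 zero_le_one continuous_const).const_mul _)]
      congr 1
      ext z
      ring
    have h1 := hf.abs_crossInt_le hc0 (t := 1) (by simp) (g := fun z => g z - g 0)
      fun z hz => hM.abs_sub_zero_le hz
    rw [hsub] at h1
    have h2 := mul_le_mul_of_nonneg_left h1 (phiFn_pos hc0).le
    rw [← abs_of_pos (phiFn_pos hc0), ← abs_mul, abs_of_pos (phiFn_pos hc0)] at h2
    have h3 := abs_add_three (phiFn c * (crossInt f c 0 1 g - g 0 * crossInt f c 0 1 fun _ => 1))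
      (g 0 * (phiFn c * crossInt f c 0 1 (fun _ => 1) - 1)) (g 0 - ∫ s in (0 : ℝ)..1, g (f s))
    rw [abs_sub_comm] at hint
    rw [abs_mul (g 0)] at h3
    refine le_trans (le_of_eq ?_) (h3.trans (add_le_add_three (h2.trans_eq ?_) le_rfl hint))
    · congr 1
      ring
    · ring
  | succ M ih =>
    intro g hg hM
    have hcell : ∀ l < 9, CrossErrorLE f 1 (fun z => g (cellMap l z)) (2 * ε) :=
      fun l hl => ih (hg.comp (continuous_cellMap l)) (hM.comp_cellMap hl)
    have h := hf.crossErrorLE_cell (i := 8) (by norm_num) (t := 1) (by simp) hg hcell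
      (hcell 8 (by norm_num))
    convert h using 1
    · norm_num
    · push_cast
      ring

theorem crossErrorLE (hf : SelfSimilarCurve f) (M : ℕ) {ε K : ℝ} (hε : 0 ≤ ε) :
    ∀ {g : ℝ → ℝ} {t : ℝ}, Continuous g → t ∈ Set.Icc (0 : ℝ) 1 →
      (∀ z ∈ Set.Icc (0 : ℝ) 1, |g z| ≤ K) → OscLE g M ε →
      CrossErrorLE f t g (2 * ε + 2 * K / 9 ^ M) := by
  induction M with
  | zero =>
    intro g t hg ht hK hM b hb
    have hK0 : 0 ≤ K := (abs_nonneg _).trans (hK 0 (by simp))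
    have hint : |∫ s in (0 : ℝ)..t, g (f s)| ≤ K := by
      have h := intervalIntegral.norm_integral_le_of_norm_le_const (a := 0) (b := t) (C := K)
        (f := fun s => g (f s)) fun s _ => hK _ (hf.mem s)
      rw [sub_zero, abs_of_nonneg ht.1] at h
      exact h.trans (mul_le_of_le_one_right hK0 ht.2)
    have hlim : Tendsto (fun c => K * (phiFn c * crossInt f c 0 1 (fun _ => 1)) + K)
        (nhdsWithin 0 (Set.Ioi 0)) (nhds (2 * K)) := by
      simpa [two_mul] using (hf.tendsto_crossInt_one.const_mul K).add_const K
    rw [pow_zero, div_one] at hb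
    filter_upwards [hlim.eventually_lt_const (show 2 * K < b by linarith),
      self_mem_nhdsWithin] with c hc hc0
    have hc0 : 0 < c := hc0
    refine lt_of_le_of_lt ((abs_sub _ _).trans (add_le_add ?_ hint)) hc
    rw [abs_mul, abs_of_pos (phiFn_pos hc0), mul_left_comm]
    exact mul_le_mul_of_nonneg_left (hf.abs_crossInt_le hc0 ht hK) (phiFn_pos hc0).le
  | succ M ih =>
    intro g t hg ht hK hM b hb
    obtain ⟨i, hi, r, hr, rfl⟩ := exists_cell ht
    refine hf.crossErrorLE_cell hi hr hg (e₁ := 2 * ε)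
      (fun l hl => hf.crossErrorLE_one M (hg.comp (continuous_cellMap l)) (hM.comp_cellMap hl))
      (ih (hg.comp (continuous_cellMap i)) hr (fun z hz => hK _ (cellMap_mem_unit hi hz))
        (hM.comp_cellMap hi)) b (lt_of_le_of_lt ?_ hb)
    have hi8 : (i : ℝ) ≤ 8 := by exact_mod_cast Nat.lt_succ_iff.1 hi
    have : 2 * K / 9 ^ (M + 1) = 1 / 9 * (2 * K / 9 ^ M) := by
      rw [pow_succ]
      field_simp
    rw [this]
    nlinarith

theorem tendsto_crossInt (hf : SelfSimilarCurve f) {g : ℝ → ℝ} (hg : Continuous g) {t : ℝ}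
    (ht : t ∈ Set.Icc (0 : ℝ) 1) :
    Tendsto (fun c => phiFn c * crossInt f c 0 t g) (nhdsWithin 0 (Set.Ioi 0))
      (nhds (∫ s in (0 : ℝ)..t, g (f s))) := by
  obtain ⟨K, hK⟩ := isCompact_Icc.exists_bound_of_continuousOn
    (hg.continuousOn (s := Set.Icc (0 : ℝ) 1))
  rw [Metric.tendsto_nhds]
  intro b hb
  obtain ⟨M₀, hM₀⟩ := hg.exists_oscLE (show 0 < b / 4 by linarith)
  have hlim : Tendsto (fun M : ℕ => 2 * K / 9 ^ M) atTop (nhds 0) := by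
    have := (tendsto_pow_atTop_nhds_zero_of_lt_one (r := (1 / 9 : ℝ)) (by norm_num)
      (by norm_num)).const_mul (2 * K)
    simpa [div_eq_mul_inv] using this
  obtain ⟨M, hM, hMM⟩ := ((hlim.eventually_lt_const (show 0 < b / 2 by linarith)).and
    (eventually_ge_atTop M₀)).exists
  exact hf.crossErrorLE M (by linarith) hg ht hK (hM₀ M hMM) b (by linarith)

end SelfSimilarCurve

namespace SelfSimilarCurve

variable {f : ℝ → ℝ}

open MeasureTheory

theorem integral_comp_cellMap_unit (l : ℕ) (g : ℝ → ℝ) :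
    ∫ z in (0 : ℝ)..1, g (cellMap l z) =
      3 * ∫ z in (((l / 3 : ℕ) : ℝ) / 3)..((((l / 3 : ℕ) : ℝ) + 1) / 3), g z := by
  generalize hk : ((l / 3 : ℕ) : ℝ) = k
  by_cases h : l % 3 = 1
  · have h1 := intervalIntegral.integral_comp_sub_mul (a := 0) (b := 1) g
      (show (1 / 3 : ℝ) ≠ 0 by norm_num) ((k + 1) / 3)
    rw [show (k + 1) / 3 - 1 / 3 * 1 = k / 3 by ring, mul_zero, sub_zero, smul_eq_mul] at h1
    rw [one_div, inv_inv] at h1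
    rw [← h1]
    congr 1
    ext z
    rw [cellMap, hk, if_pos h]
    congr 1
    ring
  · have h1 := intervalIntegral.integral_comp_add_mul (a := 0) (b := 1) g
      (show (1 / 3 : ℝ) ≠ 0 by norm_num) (k / 3)
    rw [show k / 3 + 1 / 3 * 1 = (k + 1) / 3 by ring, mul_zero, add_zero, smul_eq_mul] at h1
    rw [one_div, inv_inv] at h1
    rw [← h1]
    congr 1
    ext z
    rw [cellMap, hk, if_neg h]
    congr 1
    ring

theorem abs_integral_sub_le (hf : SelfSimilarCurve f) (M : ℕ) {ε : ℝ} :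
    ∀ {g : ℝ → ℝ}, Continuous g → OscLE g M ε →
      |(∫ s in (0 : ℝ)..1, g (f s)) - ∫ z in (0 : ℝ)..1, g z| ≤ 2 * ε := by
  induction M with
  | zero =>
    intro g hg hM
    have key : ∀ h : ℝ → ℝ, Continuous h → (∀ s ∈ Set.Icc (0 : ℝ) 1, h s ∈ Set.Icc (0 : ℝ) 1) →
        |(∫ s in (0 : ℝ)..1, g (h s)) - g 0| ≤ ε := by
      intro h hh hmem
      have hgh : IntervalIntegrable (fun s => g (h s)) volume 0 1 :=
        (hg.comp hh).intervalIntegrable _ _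
      have := intervalIntegral.norm_integral_le_of_norm_le_const (a := 0) (b := 1) (C := ε)
        (f := fun s => g (h s) - g 0) fun s hs => by
          rw [Set.uIoc_of_le zero_le_one] at hs
          exact hM.abs_sub_zero_le (hmem s ⟨hs.1.le, hs.2⟩)
      rw [intervalIntegral.integral_sub hgh intervalIntegrable_const] at this
      simpa using this
    have h1 := key f hf.uc.continuous fun s _ => hf.mem s
    have h2 := key id continuous_id fun s hs => hs
    simp only [id] at h2
    rw [abs_le] at *
    constructor <;> linarith
  | succ M ih =>
    intro g hg hM
    have hcell : ∀ l < 9, |(∫ s in (0 : ℝ)..1, g (cellMap l (f s))) -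
        ∫ z in (0 : ℝ)..1, g (cellMap l z)| ≤ 2 * ε :=
      fun l hl => ih (hg.comp (continuous_cellMap l)) (hM.comp_cellMap hl)
    have h1 : ∫ s in (0 : ℝ)..1, g (f s) =
        ∑ l ∈ Finset.range 9, 1 / 9 * ∫ s in (0 : ℝ)..1, g (cellMap l (f s)) := by
      have h := hf.integral_split (i := 8) (by norm_num) (t := 1) (by simp) hg
      rw [Finset.sum_range_succ, ← h]
      norm_num
    have hii : ∀ a b, IntervalIntegrable g volume a b := fun a b => hg.intervalIntegrable a b
    have h2 : ∫ z in (0 : ℝ)..1, g z =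
        ∑ l ∈ Finset.range 9, 1 / 9 * ∫ z in (0 : ℝ)..1, g (cellMap l z) := by
      simp only [integral_comp_cellMap_unit, Finset.sum_range_succ, Finset.sum_range_zero]
      norm_num
      rw [← intervalIntegral.integral_add_adjacent_intervals (hii 0 (1 / 3)) (hii (1 / 3) 1),
        ← intervalIntegral.integral_add_adjacent_intervals (hii (1 / 3) (2 / 3)) (hii (2 / 3) 1)]
      ring
    rw [h1, h2, ← Finset.sum_sub_distrib]
    refine (Finset.abs_sum_le_sum_abs _ _).trans ((Finset.sum_le_card_nsmul _ _
      (1 / 9 * (2 * ε)) fun l hl => ?_).trans_eq ?_)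
    · rw [← mul_sub, abs_mul, abs_of_pos (by norm_num)]
      exact mul_le_mul_of_nonneg_left (hcell l (Finset.mem_range.1 hl)) (by norm_num)
    · rw [Finset.card_range, nsmul_eq_mul]
      push_cast
      ring

theorem integral_comp_unit (hf : SelfSimilarCurve f) {g : ℝ → ℝ} (hg : Continuous g) :
    ∫ s in (0 : ℝ)..1, g (f s) = ∫ z in (0 : ℝ)..1, g z := by
  rw [← sub_eq_zero, ← abs_nonpos_iff]
  refine le_of_forall_pos_le_add fun ε hε => ?_
  obtain ⟨M, hM⟩ := hg.exists_oscLE (half_pos hε)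
  have := hf.abs_integral_sub_le M hg (hM M le_rfl)
  linarith

theorem map_volume (hf : SelfSimilarCurve f) :
    (volume.restrict (Set.Ioc (0 : ℝ) 1)).map f = volume.restrict (Set.Ioc (0 : ℝ) 1) := by
  have hfm := hf.uc.continuous.measurable
  refine ext_of_forall_integral_eq_of_IsFiniteMeasure fun g => ?_
  rw [integral_map hfm.aemeasurable g.continuous.aestronglyMeasurable,
    ← intervalIntegral.integral_of_le zero_le_one, ← intervalIntegral.integral_of_le zero_le_one]
  exact hf.integral_comp_unit g.continuous

/-- The occupation measure of `f` on `(0, t]`. -/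
def _root_.occMeasure (f : ℝ → ℝ) (t : ℝ) : Measure ℝ := (volume.restrict (Set.Ioc 0 t)).map f

theorem occMeasure_le (hf : SelfSimilarCurve f) {t : ℝ} (ht : t ≤ 1) :
    occMeasure f t ≤ volume :=
  (Measure.map_mono (Measure.restrict_mono (Set.Ioc_subset_Ioc_right ht) le_rfl)
    hf.uc.continuous.measurable).trans (hf.map_volume.trans_le Measure.restrict_le_self)

/-- The local time of `f`: the density of the occupation measure, truncated at `1`. -/
def _root_.occDensity (f : ℝ → ℝ) (t z : ℝ) : ℝ := min 1 ((occMeasure f t).rnDeriv volume z).toReal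

theorem _root_.measurable_occDensity (f : ℝ → ℝ) (t : ℝ) : Measurable (occDensity f t) :=
  measurable_const.min (Measure.measurable_rnDeriv _ _).ennreal_toReal

theorem _root_.occDensity_mem (f : ℝ → ℝ) (t z : ℝ) : occDensity f t z ∈ Set.Icc (0 : ℝ) 1 :=
  ⟨le_min zero_le_one ENNReal.toReal_nonneg, min_le_left _ _⟩

theorem integral_comp_eq (hf : SelfSimilarCurve f) {t : ℝ} (ht : t ∈ Set.Icc (0 : ℝ) 1)
    {g : ℝ → ℝ} (hg : Measurable g) :
    ∫ s in (0 : ℝ)..t, g (f s) = ∫ z, g z * occDensity f t z := by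
  have hfin : IsFiniteMeasure (occMeasure f t) := by
    unfold occMeasure
    infer_instance
  have hle := hf.occMeasure_le ht.2
  have h1 : ∫ s in (0 : ℝ)..t, g (f s) = ∫ z, g z ∂(occMeasure f t) := by
    rw [occMeasure, integral_map hf.uc.continuous.measurable.aemeasurable hg.aestronglyMeasurable,
      intervalIntegral.integral_of_le ht.1]
  rw [h1, ← integral_rnDeriv_smul (Measure.absolutelyContinuous_of_le hle)]
  refine integral_congr_ae ?_
  filter_upwards [Measure.rnDeriv_le_one_of_le hle] with z hz
  rw [occDensity, min_eq_right (ENNReal.toReal_le_of_le_ofReal zero_le_one (by simpa using hz)),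
    smul_eq_mul, mul_comm]

end SelfSimilarCurve

theorem hitTime_congr {x y : ℝ → ℝ} {t : ℝ} (h : ∀ u ∈ Set.Icc 0 t, x u = y u) {a : EReal}
    (ha : 0 ≤ a) (P : ℝ → Prop) : hitTime x t a P = hitTime y t a P := by
  unfold hitTime
  congr 2
  ext u
  simp only [Set.mem_ofPred_eq]
  refine and_congr_right fun h1 => and_congr_right fun h2 => ?_
  rw [h u ⟨by exact_mod_cast ha.trans h1, h2⟩]

theorem le_hitTime (x : ℝ → ℝ) (t : ℝ) (a : EReal) (P : ℝ → Prop) : a ≤ hitTime x t a P := by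
  refine le_sInf ?_
  rintro _ ⟨u, hu, rfl⟩
  exact hu.1

theorem crossTimes_nonneg (x : ℝ → ℝ) (z c t : ℝ) (n : ℕ) :
    0 ≤ (crossTimes x z c t n).1 ∧ 0 ≤ (crossTimes x z c t n).2 := by
  induction n with
  | zero => exact ⟨le_rfl, le_hitTime _ _ _ _⟩
  | succ n ih =>
    have h := ih.2.trans (le_hitTime x t _ (fun y => y < z - c / 2))
    exact ⟨h, h.trans (le_hitTime _ _ _ _)⟩

theorem crossTimes_congr {x y : ℝ → ℝ} {t : ℝ} (h : ∀ u ∈ Set.Icc 0 t, x u = y u) (z c : ℝ)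
    (n : ℕ) : crossTimes x z c t n = crossTimes y z c t n := by
  induction n with
  | zero => exact Prod.ext rfl (hitTime_congr h le_rfl _)
  | succ n ih =>
    have h1 := hitTime_congr h (crossTimes_nonneg x z c t n).2 (fun y => y < z - c / 2)
    have h2 := hitTime_congr h (crossTimes_nonneg x z c t (n + 1)).1 (fun y => z + c / 2 ≤ y)
    have h3 : (crossTimes x z c t (n + 1)).1 = (crossTimes y z c t (n + 1)).1 :=
      h1.trans (by rw [ih]; rfl)
    exact Prod.ext h3 (h2.trans (by rw [h3]; rfl))

theorem crossCount_congr {x y : ℝ → ℝ} {t : ℝ} (h : ∀ u ∈ Set.Icc 0 t, x u = y u) (z c : ℝ) :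
    crossCount x z c t = crossCount y z c t := by
  have h' : ∀ u ∈ Set.Icc 0 t, -x u = -y u := fun u hu => by rw [h u hu]
  simp only [crossCount, upCross, downCross, crossTimes_congr h, crossTimes_congr h']

/-- `φ(c) → 0` as `c → 0+`, and the local time `L` of the horizontal component of the Peano
curve (the density of its occupation measure with respect to Lebesgue measure, with values in
`[0,1]`) is the weak limit of the normalized numbers of interval crossings:
`∫ φ(c) n_t^{z,c}(x) g(z) dz → ∫ L_t^z g(z) dz` as `c → 0+`, for every continuous `g`. -/
theorem peano_local_time_as_crossing_limit (x : ℝ → ℝ) (hx : IsPeanoX x) :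
    Filter.Tendsto phiFn (nhdsWithin 0 (Set.Ioi 0)) (nhds 0) ∧
    ∃ L : ℝ → ℝ → ℝ,
      (∀ t ∈ Set.Icc (0 : ℝ) 1, ∀ z : ℝ, L t z ∈ Set.Icc (0 : ℝ) 1) ∧
      (∀ t ∈ Set.Icc (0 : ℝ) 1, Measurable (L t)) ∧
      (∀ t ∈ Set.Icc (0 : ℝ) 1, ∀ g : ℝ → ℝ, Measurable g → (∃ C : ℝ, ∀ z, |g z| ≤ C) →
        ∫ s in (0 : ℝ)..t, g (x s) = ∫ z : ℝ, g z * L t z) ∧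
      (∀ g : ℝ → ℝ, Continuous g → ∀ t ∈ Set.Icc (0 : ℝ) 1,
        Filter.Tendsto (fun c : ℝ => ∫ z : ℝ, phiFn c * (crossCount x z c t : ℝ) * g z)
          (nhdsWithin 0 (Set.Ioi 0)) (nhds (∫ z : ℝ, L t z * g z))) := by
  obtain ⟨f, hf, hfx⟩ := hx.exists_selfSimilarCurve
  refine ⟨tendsto_phiFn, occDensity f, fun t _ z => occDensity_mem f t z,
    fun t _ => measurable_occDensity f t, fun t ht g hg _ => ?_, fun g hg t ht => ?_⟩
  · rw [← hf.integral_comp_eq ht hg]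
    refine intervalIntegral.integral_congr fun s hs => ?_
    rw [Set.uIcc_of_le ht.1] at hs
    exact congrArg g (hfx s ⟨hs.1, hs.2.trans ht.2⟩).symm
  · have h := hf.tendsto_crossInt hg ht
    rw [hf.integral_comp_eq ht hg.measurable] at h
    simp only [mul_comm (occDensity f t _)]
    refine h.congr' ?_
    filter_upwards [self_mem_nhdsWithin] with c hc
    have hc : 0 < c := hc
    rw [crossInt, ← MeasureTheory.integral_const_mul]
    congr 1
    ext z
    rw [crossCount_congr (fun u hu => (hfx u ⟨hu.1, hu.2.trans ht.2⟩).symm),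
      crossCount_eq hf.uc.continuous hc ht.1, mul_assoc]
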